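/- arXiv:1501.06975 — 2 statements merged into one kernel-verified Lean document; each statement's English description precedes it below -/
import Mathlib

section
/- There is an effective absolute constant C > 0 such that for every fundamental quadratic discriminant Δ < 0 with associated Kronecker symbol χ = (Δ/·), and every real y ≥ exp(√|Δ|), the tail of the convergent series satisfies |∑_{p > y, p prime} χ(p)/p| ≤ C. -/
/-- The Kronecker symbol `(Δ/p)` at a prime `p` (agreeing with the Legendre/Jacobi symbol at
odd primes, with the usual convention at `p = 2`). -/
def kroneckerAtPrime (Δ : ℤ) (p : ℕ) : ℤ :=
  if p = 2 then (if Δ % 2 = 0 then 0 else if Δ % 8 = 1 ∨ Δ % 8 = 7 then 1 else -1)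
  else jacobiSym Δ p

/-- `Δ` is a fundamental quadratic discriminant: either `Δ ≡ 1 (mod 4)` and squarefree,
or `Δ = 4m` with `m ≡ 2, 3 (mod 4)` squarefree. -/
def IsFundamentalDiscriminant (Δ : ℤ) : Prop :=
  (Δ % 4 = 1 ∧ Squarefree Δ) ∨
    (Δ % 4 = 0 ∧ Squarefree (Δ / 4) ∧ ((Δ / 4) % 4 = 2 ∨ (Δ / 4) % 4 = 3))

section

open Real ArithmeticFunction Filter Topology

lemma summable_pnat_rpow_neg {s : ℝ} (hs : 1 < s) : Summable fun n : ℕ+ => (n : ℝ) ^ (-s) :=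
  (Real.summable_nat_rpow.mpr (by linarith)).comp_injective PNat.coe_injective

/-- Regrouping an absolutely convergent double series along the fibres of multiplication. -/
lemma hasSum_arithmeticFunction_mul {g h : ArithmeticFunction ℝ} {φ : ℕ → ℝ} {S : ℝ}
    (H : HasSum (fun x : ℕ+ × ℕ+ => g x.1 * h x.2 * φ (x.1 * x.2)) S) :
    HasSum (fun n : ℕ+ => (g * h) n * φ n) S := by
  refine (sigmaAntidiagonalEquivProd.hasSum_iff.mpr H).sigma fun n => ?_
  have h1 := hasSum_fintype (fun x : (n : ℕ).divisorsAntidiagonal => g x.1.1 * h x.1.2 * φ n)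
  rw [Finset.sum_coe_sort (n : ℕ).divisorsAntidiagonal (fun x => g x.1 * h x.2 * φ n),
    ← Finset.sum_mul, ← ArithmeticFunction.mul_apply] at h1
  convert h1 using 2 with x
  have hx : (x.1.1 * x.1.2 : ℕ) = n := (Nat.mem_divisorsAntidiagonal.mp x.2).1
  simp [sigmaAntidiagonalEquivProd, divisorsAntidiagonalFactors, ← hx]

lemma hasSum_rpow_neg_sub {δ : ℝ} (hδ : 0 < δ) :
    HasSum (fun n : ℕ => ((n : ℝ) + 1) ^ (-δ) - ((n : ℝ) + 2) ^ (-δ)) 1 := by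
  rw [hasSum_iff_tendsto_nat_of_nonneg]
  · have h1 : ∀ N : ℕ, ∑ n ∈ Finset.range N, (((n : ℝ) + 1) ^ (-δ) - ((n : ℝ) + 2) ^ (-δ))
        = 1 - ((N : ℝ) + 1) ^ (-δ) := by
      intro N
      have := Finset.sum_range_sub' (fun n : ℕ => ((n : ℝ) + 1) ^ (-δ)) N
      simp only [Nat.cast_add, Nat.cast_one, Nat.cast_zero, zero_add, Real.one_rpow, add_assoc,
        one_add_one_eq_two] at this
      exact this
    simp only [h1]
    have h2 : Tendsto (fun N : ℕ => ((N : ℝ) + 1) ^ (-δ)) atTop (𝓝 0) :=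
      (tendsto_rpow_neg_atTop hδ).comp
        (tendsto_atTop_add_const_right _ _ tendsto_natCast_atTop_atTop)
    simpa using h2.const_sub 1
  · intro n
    have : ((n : ℝ) + 2) ^ (-δ) ≤ ((n : ℝ) + 1) ^ (-δ) :=
      Real.rpow_le_rpow_of_nonpos (by positivity) (by linarith) (by linarith)
    linarith

lemma rpow_neg_sub_le {δ x : ℝ} (hδ : 0 < δ) (hx : 0 < x) :
    x ^ (-δ) - (x + 1) ^ (-δ) ≤ δ * x ^ (-(1 + δ)) := by
  have h1 : (x + 1) ^ (-δ) = x ^ (-δ) * (1 + 1 / x) ^ (-δ) := by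
    rw [← Real.mul_rpow hx.le (by positivity)]
    congr 1
    field_simp
  have h2 : 1 - δ / x ≤ (1 + 1 / x) ^ (-δ) := by
    rw [Real.rpow_def_of_pos (by positivity)]
    have h3 : Real.log (1 + 1 / x) ≤ 1 / x := by
      have := Real.log_le_sub_one_of_pos (x := 1 + 1 / x) (by positivity)
      linarith
    have h4 := Real.add_one_le_exp (Real.log (1 + 1 / x) * -δ)
    have h5 : δ * Real.log (1 + 1 / x) ≤ δ * (1 / x) := by gcongr
    have h6 : δ * (1 / x) = δ / x := by ring
    linarith
  have h3 : x ^ (-(1 + δ)) = x ^ (-δ) / x := by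
    rw [neg_add, Real.rpow_add hx, Real.rpow_neg_one]; ring
  rw [h1, h3]
  have h4 : 0 < x ^ (-δ) := by positivity
  have h5 := mul_le_mul_of_nonneg_left h2 h4.le
  have h6 : x ^ (-δ) * (1 - δ / x) = x ^ (-δ) - δ * (x ^ (-δ) / x) := by ring
  linarith

lemma le_rpow_neg_sub {δ x : ℝ} (hδ : 0 < δ) (hx : 0 < x) :
    δ * (x + 1) ^ (-(1 + δ)) ≤ x ^ (-δ) - (x + 1) ^ (-δ) := by
  have hx1 : 0 < x + 1 := by linarith
  have h1 : x ^ (-δ) = (x + 1) ^ (-δ) * ((x + 1) / x) ^ δ := by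
    rw [Real.div_rpow hx1.le hx.le, Real.rpow_neg hx1.le, Real.rpow_neg hx.le]
    field_simp
  have h2 : 1 + δ / (x + 1) ≤ ((x + 1) / x) ^ δ := by
    rw [Real.rpow_def_of_pos (by positivity)]
    have h3 := Real.one_sub_inv_le_log_of_pos (x := (x + 1) / x) (by positivity)
    have h4 := Real.add_one_le_exp (Real.log ((x + 1) / x) * δ)
    have h5 : 1 - ((x + 1) / x)⁻¹ = 1 / (x + 1) := by field_simp; ring
    rw [h5] at h3
    have h6 : 1 / (x + 1) * δ ≤ Real.log ((x + 1) / x) * δ := by gcongr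
    have h7 : 1 / (x + 1) * δ = δ / (x + 1) := by ring
    linarith
  have h3 : (x + 1) ^ (-(1 + δ)) = (x + 1) ^ (-δ) / (x + 1) := by
    rw [neg_add, Real.rpow_add hx1, Real.rpow_neg_one]; ring
  rw [h1, h3]
  have h4 : 0 < (x + 1) ^ (-δ) := by positivity
  have h5 := mul_le_mul_of_nonneg_left h2 h4.le
  have h6 : (x + 1) ^ (-δ) * (1 + δ / (x + 1))
    = (x + 1) ^ (-δ) + δ * ((x + 1) ^ (-δ) / (x + 1)) := by ring
  linarith

lemma inv_le_tsum_rpow_neg {δ : ℝ} (hδ : 0 < δ) :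
    1 / δ ≤ ∑' n : ℕ+, (n : ℝ) ^ (-(1 + δ)) := by
  have hs := summable_pnat_rpow_neg (s := 1 + δ) (by linarith)
  have hs' : Summable fun n : ℕ => ((n : ℝ) + 1) ^ (-(1 + δ)) := by
    have := (summable_pnat_iff_summable_succ (f := fun n : ℕ => (n : ℝ) ^ (-(1 + δ)))).mp hs
    simpa using this
  have e : ∑' n : ℕ+, (n : ℝ) ^ (-(1 + δ)) = ∑' n : ℕ, ((n : ℝ) + 1) ^ (-(1 + δ)) := by
    rw [tsum_pnat_eq_tsum_succ (f := fun n : ℕ => (n : ℝ) ^ (-(1 + δ)))]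
    simp
  rw [e, div_le_iff₀ hδ, mul_comm, ← tsum_mul_left]
  refine hasSum_le (fun n => ?_) (hasSum_rpow_neg_sub hδ) (hs'.mul_left δ).hasSum
  have := rpow_neg_sub_le hδ (x := (n : ℝ) + 1) (by positivity)
  rwa [add_assoc, one_add_one_eq_two] at this

lemma tsum_rpow_neg_le {δ : ℝ} (hδ : 0 < δ) :
    ∑' n : ℕ+, (n : ℝ) ^ (-(1 + δ)) ≤ 1 + 1 / δ := by
  have hs := summable_pnat_rpow_neg (s := 1 + δ) (by linarith)
  have hs' : Summable fun n : ℕ => ((n : ℝ) + 1) ^ (-(1 + δ)) := by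
    have := (summable_pnat_iff_summable_succ (f := fun n : ℕ => (n : ℝ) ^ (-(1 + δ)))).mp hs
    simpa using this
  have hs'' : Summable fun n : ℕ => ((n : ℝ) + 2) ^ (-(1 + δ)) := by
    have := (summable_nat_add_iff 1).mpr hs'
    refine this.congr fun n => ?_
    push_cast
    congr 1
    ring
  have e : ∑' n : ℕ+, (n : ℝ) ^ (-(1 + δ)) = 1 + ∑' n : ℕ, ((n : ℝ) + 2) ^ (-(1 + δ)) := by
    rw [tsum_pnat_eq_tsum_succ (f := fun n : ℕ => (n : ℝ) ^ (-(1 + δ)))]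
    simp only [Nat.cast_add, Nat.cast_one]
    rw [hs'.tsum_eq_zero_add]
    simp [add_assoc, one_add_one_eq_two]
  rw [e]
  gcongr
  rw [le_div_iff₀ hδ, mul_comm, ← tsum_mul_left]
  refine hasSum_le (fun n => ?_) (hs''.mul_left δ).hasSum (hasSum_rpow_neg_sub hδ)
  have := le_rpow_neg_sub hδ (x := (n : ℝ) + 1) (by positivity)
  rwa [add_assoc, one_add_one_eq_two] at this

lemma log_mul_rpow_neg_le {δ x : ℝ} (hδ : 0 < δ) (hx : 0 < x) :
    Real.log x * x ^ (-(1 + δ)) ≤ 2 / δ * x ^ (-(1 + δ / 2)) := by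
  have h := Real.log_le_rpow_div hx.le (half_pos hδ)
  have e : x ^ (-(1 + δ / 2)) = x ^ (δ / 2) * x ^ (-(1 + δ)) := by
    rw [← Real.rpow_add hx]; congr 1; ring
  rw [e]
  calc Real.log x * x ^ (-(1 + δ)) ≤ x ^ (δ / 2) / (δ / 2) * x ^ (-(1 + δ)) := by gcongr
    _ = _ := by field_simp

lemma summable_vonMangoldt_rpow_neg {δ : ℝ} (hδ : 0 < δ) :
    Summable fun n : ℕ+ => Λ n * (n : ℝ) ^ (-(1 + δ)) := by
  refine Summable.of_nonneg_of_le (fun n => mul_nonneg vonMangoldt_nonneg (by positivity))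
    (fun n => ?_) ((summable_pnat_rpow_neg (s := 1 + δ / 2) (by linarith)).mul_left (2 / δ))
  have hn : (0 : ℝ) < n := by exact_mod_cast n.pos
  refine le_trans ?_ (log_mul_rpow_neg_le hδ hn)
  gcongr
  exact vonMangoldt_le_log

lemma tsum_vonMangoldt_rpow_neg_le {δ : ℝ} (hδ : 0 < δ) (hδ1 : δ ≤ 1) :
    ∑' n : ℕ+, Λ n * (n : ℝ) ^ (-(1 + δ)) ≤ 6 / δ := by
  have hΛ := summable_vonMangoldt_rpow_neg hδ
  have hz := summable_pnat_rpow_neg (s := 1 + δ) (by linarith)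
  have hz2 := summable_pnat_rpow_neg (s := 1 + δ / 2) (by linarith)
  have hprod := hΛ.hasSum.mul hz.hasSum (hΛ.mul_of_nonneg hz
    (fun n => mul_nonneg vonMangoldt_nonneg (by positivity)) (fun n => by positivity))
  have hlog : HasSum (fun n : ℕ+ => Real.log n * (n : ℝ) ^ (-(1 + δ)))
      ((∑' n : ℕ+, Λ n * (n : ℝ) ^ (-(1 + δ))) * ∑' n : ℕ+, (n : ℝ) ^ (-(1 + δ))) := by
    simp_rw [← ArithmeticFunction.log_apply, ← vonMangoldt_mul_zeta]
    refine hasSum_arithmeticFunction_mul (φ := fun n => (n : ℝ) ^ (-(1 + δ))) ?_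
    have e : (fun x : ℕ+ × ℕ+ => Λ x.1 * (ArithmeticFunction.zeta : ArithmeticFunction ℝ) x.2
        * ((x.1 * x.2 : ℕ) : ℝ) ^ (-(1 + δ)))
        = fun x => Λ x.1 * (x.1 : ℝ) ^ (-(1 + δ)) * (x.2 : ℝ) ^ (-(1 + δ)) := by
      funext x
      simp [Real.mul_rpow, natCoe_apply, zeta_apply, mul_assoc]
    rw [e]
    exact hprod
  set D := ∑' n : ℕ+, Λ n * (n : ℝ) ^ (-(1 + δ))
  have hD : 0 ≤ D := tsum_nonneg fun n => mul_nonneg vonMangoldt_nonneg (by positivity)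
  have h1 : D * (1 / δ) ≤ 2 / δ * (1 + 1 / (δ / 2)) := by
    calc D * (1 / δ) ≤ D * ∑' n : ℕ+, (n : ℝ) ^ (-(1 + δ)) := by
          gcongr; exact inv_le_tsum_rpow_neg hδ
      _ = ∑' n : ℕ+, Real.log n * (n : ℝ) ^ (-(1 + δ)) := hlog.tsum_eq.symm
      _ ≤ ∑' n : ℕ+, 2 / δ * (n : ℝ) ^ (-(1 + δ / 2)) :=
          hlog.summable.tsum_le_tsum
            (fun n => log_mul_rpow_neg_le hδ (by exact_mod_cast n.pos)) (hz2.mul_left _)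
      _ ≤ _ := by
          rw [tsum_mul_left]; gcongr; exact tsum_rpow_neg_le (half_pos hδ)
  have h2 : D = D * (1 / δ) * δ := by field_simp
  rw [h2]
  calc D * (1 / δ) * δ ≤ 2 / δ * (1 + 1 / (δ / 2)) * δ := by gcongr
    _ = (2 * δ + 4) / δ := by field_simp; ring
    _ ≤ 6 / δ := by gcongr; linarith

end

section

open Real ArithmeticFunction Filter Topology

lemma prime_rpow_neg_le_half {s : ℝ} (hs : 1 < s) (p : Nat.Primes) : (p : ℝ) ^ (-s) ≤ 1 / 2 := by
  have hp : (2 : ℝ) ≤ p := by exact_mod_cast p.2.two_le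
  calc (p : ℝ) ^ (-s) ≤ (p : ℝ) ^ (-1 : ℝ) :=
        Real.rpow_le_rpow_of_exponent_le (by linarith) (by linarith)
    _ = (p : ℝ)⁻¹ := Real.rpow_neg_one _
    _ ≤ 1 / 2 := by rw [one_div]; gcongr

lemma summable_primes_inv_sq : Summable fun p : Nat.Primes => (p : ℝ) ^ (-2 : ℝ) :=
  (Real.summable_nat_rpow.mpr (by norm_num)).comp_injective Nat.Primes.coe_nat_injective

lemma abs_neg_log_one_sub_sub_le {x : ℝ} (hx : |x| ≤ 1 / 2) :
    |-Real.log (1 - x) - x| ≤ 2 * |x| ^ 2 := by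
  have h := Real.abs_log_sub_add_sum_range_le (x := x) (by linarith) 1
  simp only [Finset.sum_range_one, zero_add, pow_one, Nat.cast_zero, div_one] at h
  rw [← abs_neg, neg_sub, sub_neg_eq_add]
  refine h.trans ?_
  rw [div_le_iff₀ (by linarith)]
  norm_num only [Nat.reduceAdd]
  nlinarith [sq_nonneg |x|]

lemma log_tsum_sub_tsum_primes {s : ℝ} (hs : 1 < s) (f : ℕ →*₀ ℝ)
    (hf : ∀ n : ℕ, |f n| ≤ (n : ℝ) ^ (-s)) :
    0 < ∑' n, f n ∧ |Real.log (∑' n, f n) - ∑' p : Nat.Primes, f p|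
      ≤ 2 * ∑' p : Nat.Primes, (p : ℝ) ^ (-2 : ℝ) := by
  have hsum : Summable fun n => ‖f n‖ :=
    Summable.of_nonneg_of_le (fun n => norm_nonneg _) hf (Real.summable_nat_rpow.mpr (by linarith))
  have hprod := EulerProduct.eulerProduct_completely_multiplicative_hasProd hsum
  have hsp : Summable fun p : Nat.Primes => f p :=
    (Summable.of_norm hsum).comp_injective Nat.Primes.coe_nat_injective
  have hhalf (p : Nat.Primes) : |f p| ≤ 1 / 2 := (hf p).trans (prime_rpow_neg_le_half hs p)
  have hdiff (p : Nat.Primes) : ‖-Real.log (1 - f p) - f p‖ ≤ 2 * (p : ℝ) ^ (-2 : ℝ) := by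
    refine (abs_neg_log_one_sub_sub_le (hhalf p)).trans ?_
    have hp : (1 : ℝ) ≤ p := by exact_mod_cast p.2.one_le
    have h1 : |f p| ≤ (p : ℝ) ^ (-1 : ℝ) :=
      (hf p).trans (Real.rpow_le_rpow_of_exponent_le hp (by linarith))
    have h2 : (p : ℝ) ^ (-2 : ℝ) = ((p : ℝ) ^ (-1 : ℝ)) ^ 2 := by
      rw [← Real.rpow_natCast, ← Real.rpow_mul (by linarith)]; norm_num
    rw [h2]
    gcongr
  have hs2 := summable_primes_inv_sq.mul_left 2
  have hsd : Summable fun p : Nat.Primes => -Real.log (1 - f p) - f p :=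
    Summable.of_norm_bounded hs2 hdiff
  have hlog : Summable fun p : Nat.Primes => Real.log ((1 - f p)⁻¹) := by
    simpa [Real.log_inv] using hsd.add hsp
  have hexp := Real.rexp_tsum_eq_tprod (f := fun p : Nat.Primes => (1 - f p)⁻¹)
    (fun p => inv_pos.mpr (by linarith [(abs_le.mp (hhalf p)).2])) hlog
  rw [hprod.tprod_eq] at hexp
  refine ⟨hexp ▸ Real.exp_pos _, ?_⟩
  rw [← hexp, Real.log_exp, ← hlog.tsum_sub hsp, ← tsum_mul_left]
  simp only [Real.log_inv]
  exact tsum_of_norm_bounded hs2.hasSum hdiff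

lemma abs_sub_ite_le {δ c x : ℝ} (hδ : 0 < δ) (hc : |c| ≤ 1) (hx : 1 ≤ x) :
    |c * x ^ (-(1 + δ)) - if x ≤ Real.exp (1 / δ) then c / x else 0|
      ≤ 3 * δ * (Real.log x * x ^ (-(1 + δ))) := by
  have hx0 : 0 < x := by linarith
  have hl : 0 ≤ Real.log x := Real.log_nonneg hx
  have hpos : 0 < x ^ (-(1 + δ)) := by positivity
  split_ifs with h
  · have hlog : Real.log x * δ ≤ 1 := by
      have := (Real.log_le_iff_le_exp hx0).mpr h
      rwa [le_div_iff₀ hδ] at this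
    have e : 1 / x = x ^ (-(1 + δ)) * x ^ δ := by
      rw [← Real.rpow_add hx0]
      simp [Real.rpow_neg_one]
    have h1 : x ^ δ ≤ 1 + 3 * (Real.log x * δ) := by
      rw [Real.rpow_def_of_pos hx0]
      set u := Real.log x * δ
      have hu : 0 ≤ u := by positivity
      have h1 := Real.add_one_le_exp (-u)
      have h2 : Real.exp u ≤ 3 := (Real.exp_le_exp.mpr hlog).trans (by
        have := Real.exp_one_lt_d9; linarith)
      have h3 : Real.exp u * Real.exp (-u) = 1 := by rw [← Real.exp_add]; simp
      nlinarith [Real.exp_pos u]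
    have h2 : 1 ≤ x ^ δ := Real.one_le_rpow hx hδ.le
    have : c * x ^ (-(1 + δ)) - c / x = -(c * (x ^ (-(1 + δ)) * (x ^ δ - 1))) := by
      have : c / x = c * (1 / x) := by ring
      rw [this, e]; ring
    rw [this, abs_neg, abs_mul, abs_of_nonneg (mul_nonneg hpos.le (by linarith))]
    have h3 : x ^ δ - 1 ≤ 3 * (Real.log x * δ) := by linarith
    calc |c| * (x ^ (-(1 + δ)) * (x ^ δ - 1)) ≤ 1 * (x ^ (-(1 + δ)) * (3 * (Real.log x * δ))) :=
          mul_le_mul hc (by gcongr) (mul_nonneg hpos.le (by linarith)) zero_le_one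
      _ = _ := by ring
  · have hlog : 1 ≤ Real.log x * δ := by
      have := (Real.lt_log_iff_exp_lt hx0).mpr (not_le.mp h)
      rw [div_lt_iff₀ hδ] at this
      exact this.le
    rw [sub_zero, abs_mul, abs_of_pos hpos]
    calc |c| * x ^ (-(1 + δ)) ≤ 1 * x ^ (-(1 + δ)) := by gcongr
      _ ≤ (3 * (Real.log x * δ)) * x ^ (-(1 + δ)) := by gcongr; linarith
      _ = _ := by ring

lemma abs_tsum_primes_sub_sum_le {δ : ℝ} (hδ : 0 < δ) (hδ1 : δ ≤ 1) (c : ℕ → ℝ)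
    (hc : ∀ n, |c n| ≤ 1) :
    |∑' p : Nat.Primes, c p * (p : ℝ) ^ (-(1 + δ))
      - ∑ p ∈ (Finset.range (⌊Real.exp (1 / δ)⌋₊ + 1)).filter Nat.Prime, c p / p| ≤ 18 := by
  set Y := Real.exp (1 / δ)
  have hfin : HasSum (fun p : Nat.Primes => if (p : ℝ) ≤ Y then c p / p else 0)
      (∑ p ∈ (Finset.range (⌊Y⌋₊ + 1)).filter Nat.Prime, c p / p) := by
    have h0 := hasSum_sum_of_ne_finset_zero (L := SummationFilter.unconditional ℕ)
      (s := (Finset.range (⌊Y⌋₊ + 1)).filter Nat.Prime)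
      (f := Set.indicator {p : ℕ | p.Prime} fun p : ℕ => if (p : ℝ) ≤ Y then c p / p else 0) (by
        intro p hp
        by_cases hpp : p.Prime
        · have : ¬ (p : ℝ) ≤ Y := by
            intro h
            exact hp (Finset.mem_filter.mpr
              ⟨Finset.mem_range.mpr (Nat.lt_succ_of_le (Nat.le_floor h)), hpp⟩)
          simp [this]
        · simp [hpp])
    have h1 := (hasSum_subtype_iff_indicator (s := {p : ℕ | p.Prime})
      (f := fun p : ℕ => if (p : ℝ) ≤ Y then c p / p else 0)).mpr h0
    have e : ∑ p ∈ (Finset.range (⌊Y⌋₊ + 1)).filter Nat.Prime, c p / p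
        = ∑ p ∈ (Finset.range (⌊Y⌋₊ + 1)).filter Nat.Prime,
          Set.indicator {p : ℕ | p.Prime} (fun p : ℕ => if (p : ℝ) ≤ Y then c p / p else 0) p := by
      refine Finset.sum_congr rfl fun p hp => ?_
      obtain ⟨hp1, hp2⟩ := Finset.mem_filter.mp hp
      have : (p : ℝ) ≤ Y :=
        (Nat.le_floor_iff (Real.exp_pos _).le).mp (Nat.lt_succ_iff.mp (Finset.mem_range.mp hp1))
      simp [hp2, this]
    rw [e]
    exact h1
  have hΛ := summable_vonMangoldt_rpow_neg hδ
  have hinj : Function.Injective fun p : Nat.Primes => (⟨(p : ℕ), Nat.Prime.pos p.2⟩ : ℕ+) := by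
    intro p q h
    exact Nat.Primes.coe_nat_injective (congrArg PNat.val h)
  have hlog : Summable fun p : Nat.Primes => Real.log p * (p : ℝ) ^ (-(1 + δ)) := by
    refine (hΛ.comp_injective hinj).congr fun p => ?_
    change Λ (p : ℕ) * _ = _
    rw [vonMangoldt_apply_prime p.2]
    rfl
  have hlogle : ∑' p : Nat.Primes, Real.log p * (p : ℝ) ^ (-(1 + δ)) ≤ 6 / δ := by
    refine le_trans ?_ (tsum_vonMangoldt_rpow_neg_le hδ hδ1)
    refine hlog.tsum_le_tsum_of_inj _ hinj
      (fun n _ => mul_nonneg vonMangoldt_nonneg (by positivity)) (fun p => ?_) hΛ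
    change _ ≤ Λ (p : ℕ) * _
    rw [vonMangoldt_apply_prime p.2]
    rfl
  have hcs : Summable fun p : Nat.Primes => c p * (p : ℝ) ^ (-(1 + δ)) := by
    have : Summable fun n : ℕ => c n * (n : ℝ) ^ (-(1 + δ)) := by
      refine Summable.of_norm_bounded
        (Real.summable_nat_rpow.mpr (show -(1 + δ) < -1 by linarith)) fun n => ?_
      rw [norm_mul, Real.norm_eq_abs, Real.norm_of_nonneg (by positivity)]
      exact mul_le_of_le_one_left (by positivity) (hc n)
    exact this.comp_injective Nat.Primes.coe_nat_injective
  rw [← hfin.tsum_eq, ← hcs.tsum_sub hfin.summable, ← Real.norm_eq_abs]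
  refine (tsum_of_norm_bounded (hlog.mul_left (3 * δ)).hasSum fun p => ?_).trans ?_
  · exact abs_sub_ite_le hδ (hc p) (by exact_mod_cast p.2.one_le)
  · rw [tsum_mul_left]
    calc 3 * δ * ∑' p : Nat.Primes, Real.log p * (p : ℝ) ^ (-(1 + δ)) ≤ 3 * δ * (6 / δ) := by gcongr
      _ = 18 := by field_simp; norm_num

/-- A completely multiplicative function multiplied by `n ^ (-s)`. -/
noncomputable def dirichletTermHom (c : ℕ →*₀ ℝ) (s : ℝ) : ℕ →*₀ ℝ where
  toFun n := c n * (n : ℝ) ^ (-s)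
  map_zero' := by simp
  map_one' := by simp
  map_mul' m n := by
    simp only [map_mul, Nat.cast_mul]
    rw [Real.mul_rpow (by positivity) (by positivity)]
    ring

lemma exists_abs_log_tsum_sub_sum_primes_le :
    ∃ C : ℝ, ∀ c : ℕ →*₀ ℝ, (∀ n, |c n| ≤ 1) → ∀ δ : ℝ, 0 < δ → δ ≤ 1 →
      0 < ∑' n : ℕ, c n * (n : ℝ) ^ (-(1 + δ)) ∧
      |Real.log (∑' n : ℕ, c n * (n : ℝ) ^ (-(1 + δ)))
        - ∑ p ∈ (Finset.range (⌊Real.exp (1 / δ)⌋₊ + 1)).filter Nat.Prime, c p / p| ≤ C := by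
  refine ⟨2 * (∑' p : Nat.Primes, (p : ℝ) ^ (-2 : ℝ)) + 18, fun c hc δ hδ hδ1 => ?_⟩
  have h1 := log_tsum_sub_tsum_primes (s := 1 + δ) (by linarith)
    (dirichletTermHom c (1 + δ)) (fun n => by
      change |c n * (n : ℝ) ^ (-(1 + δ))| ≤ _
      rw [abs_mul, abs_of_nonneg (a := (n : ℝ) ^ (-(1 + δ))) (by positivity)]
      exact mul_le_of_le_one_left (by positivity) (hc n))
  have h2 := abs_tsum_primes_sub_sum_le hδ hδ1 c hc
  refine ⟨h1.1, ?_⟩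
  have := (abs_sub_le _ _ _).trans (add_le_add h1.2 h2)
  exact this

end

lemma jacobiSym_natCast_val {Δ : ℤ} {n : ℕ} (hn : Odd n) :
    jacobiSym Δ ((n : ZMod (4 * Δ.natAbs)).val) = jacobiSym Δ n := by
  rw [ZMod.val_natCast, ← jacobiSym.mod_right Δ hn]

lemma odd_val_of_isUnit {D : ℕ} {a : ZMod (4 * D)} (ha : IsUnit a) [NeZero (4 * D)] :
    Odd a.val := by
  have h : (a.val).Coprime (4 * D) := by
    rw [← ZMod.isUnit_iff_coprime, ZMod.natCast_zmod_val]
    exact ha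
  have h2 : (a.val).Coprime 2 := h.coprime_dvd_right ⟨2 * D, by ring⟩
  exact Nat.coprime_two_right.mp h2

open Classical in
/-- The quadratic character modulo `4 |Δ|` whose values are the Jacobi symbols `(Δ/n)`. -/
noncomputable def jacobiDirichletChar (Δ : ℤ) [NeZero (4 * Δ.natAbs)] :
    DirichletCharacter ℂ (4 * Δ.natAbs) where
  toFun a := if IsUnit a then (jacobiSym Δ a.val : ℂ) else 0
  map_one' := by
    have h := jacobiSym_natCast_val (Δ := Δ) (n := 1) odd_one
    rw [Nat.cast_one, jacobiSym.one_right] at h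
    simp [h]
  map_mul' a b := by
    by_cases ha : IsUnit a <;> by_cases hb : IsUnit b
    · have h := jacobiSym_natCast_val (Δ := Δ) (n := a.val * b.val)
        ((odd_val_of_isUnit ha).mul (odd_val_of_isUnit hb))
      rw [Nat.cast_mul, ZMod.natCast_zmod_val, ZMod.natCast_zmod_val] at h
      have ha0 : NeZero a.val := ⟨(odd_val_of_isUnit ha).pos.ne'⟩
      have hb0 : NeZero b.val := ⟨(odd_val_of_isUnit hb).pos.ne'⟩
      rw [jacobiSym.mul_right] at h
      simp [ha, hb, h]
    · simp [hb]
    · simp [ha]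
    · simp [ha]
  map_nonunit' a ha := by simp [ha]

lemma jacobiDirichletChar_apply {Δ : ℤ} [NeZero (4 * Δ.natAbs)] {n : ℕ}
    (hn : n.Coprime (4 * Δ.natAbs)) : jacobiDirichletChar Δ n = jacobiSym Δ n := by
  have hodd : Odd n := Nat.coprime_two_right.mp (hn.coprime_dvd_right ⟨2 * Δ.natAbs, by ring⟩)
  change (if IsUnit ((n : ℕ) : ZMod (4 * Δ.natAbs)) then _ else _) = _
  rw [if_pos ((ZMod.isUnit_iff_coprime _ _).mpr hn), jacobiSym_natCast_val hodd]

lemma jacobiDirichletChar_sq (Δ : ℤ) [NeZero (4 * Δ.natAbs)] : jacobiDirichletChar Δ ^ 2 = 1 := by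
  ext a
  rw [MulChar.pow_apply_coe, MulChar.one_apply_coe]
  have hc : ((a : ZMod (4 * Δ.natAbs)).val).Coprime (4 * Δ.natAbs) := by
    rw [← ZMod.isUnit_iff_coprime, ZMod.natCast_zmod_val]
    exact a.isUnit
  have h := jacobiDirichletChar_apply hc
  rw [ZMod.natCast_zmod_val] at h
  rw [h]
  have : Δ.gcd ((a : ZMod (4 * Δ.natAbs)).val : ℤ) = 1 := by
    have := (hc.coprime_dvd_right (Dvd.intro_left 4 rfl)).symm
    exact this
  exact_mod_cast jacobiSym.sq_one this

lemma jacobiDirichletChar_odd {Δ : ℤ} (hΔ : Δ < 0) [NeZero (4 * Δ.natAbs)] :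
    (jacobiDirichletChar Δ).Odd := by
  obtain ⟨D, hD⟩ : ∃ D : ℕ, Δ = -(D : ℤ) := ⟨Δ.natAbs, by omega⟩
  have hD0 : 0 < D := by omega
  have hDa : Δ.natAbs = D := by omega
  have hc : (4 * D - 1).Coprime (4 * Δ.natAbs) := by
    rw [hDa]
    have := (Nat.coprime_self_sub_right (show 1 ≤ 4 * D by omega)).mpr (Nat.coprime_one_right (4 * D))
    exact this.symm
  have h := jacobiDirichletChar_apply hc
  have e : ((4 * D - 1 : ℕ) : ZMod (4 * Δ.natAbs)) = -1 := by
    rw [Nat.cast_sub (by omega), ← hDa, ZMod.natCast_self]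
    simp
  rw [e] at h
  have hodd : Odd (4 * D - 1) := ⟨2 * D - 1, by omega⟩
  rw [DirichletCharacter.Odd, h, hD, ← neg_one_mul, jacobiSym.mul_left, jacobiSym.at_neg_one hodd]
  have h4 : jacobiSym 4 (4 * D - 1) = 1 := by
    have := jacobiSym.sq_one (a := 2) (b := 4 * D - 1) (by
      have : (2 : ℕ).Coprime (4 * D - 1) := (Nat.coprime_two_left).mpr hodd
      simpa [Int.gcd] using this)
    rw [← jacobiSym.pow_left] at this
    exact this
  have hDD : jacobiSym (D : ℤ) (4 * D - 1) = 1 := by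
    have h1 : jacobiSym (4 * (D : ℤ)) (4 * D - 1) = 1 := by
      have : (4 * (D : ℤ)) % ((4 * D - 1 : ℕ) : ℤ) = 1 % ((4 * D - 1 : ℕ) : ℤ) := by
        rw [show (4 * (D : ℤ)) = 1 + ((4 * D - 1 : ℕ) : ℤ) by omega]
        simp
      rw [jacobiSym.mod_left' this, jacobiSym.one_left]
    rwa [jacobiSym.mul_left, h4, one_mul] at h1
  rw [hDD, ZMod.χ₄_nat_three_mod_four (by omega)]
  simp

lemma exists_primitive_quadratic_char {Δ : ℤ} (hΔ : Δ < 0) :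
    ∃ (q : ℕ) (χ : DirichletCharacter ℂ q), χ.IsPrimitive ∧ χ.Odd ∧ χ.IsQuadratic ∧
      q ∣ 4 * Δ.natAbs ∧ ∀ n : ℕ, n.Coprime (4 * Δ.natAbs) → χ n = jacobiSym Δ n := by
  have : NeZero (4 * Δ.natAbs) := ⟨by omega⟩
  set χ₀ := jacobiDirichletChar Δ with hχ₀
  have hdvd := χ₀.conductor_dvd_level
  have hch : DirichletCharacter.changeLevel hdvd χ₀.primitiveCharacter = χ₀ :=
    χ₀.changeLevel_primitiveCharacter
  have hval (a : ℤ) (ha : IsCoprime a (4 * Δ.natAbs : ℕ)) : χ₀.primitiveCharacter a = χ₀ a :=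
    χ₀.primitiveCharacter_apply_of_isCoprime ha
  refine ⟨χ₀.conductor, χ₀.primitiveCharacter, χ₀.primitiveCharacter_isPrimitive, ?_, ?_, hdvd,
    fun n hn => ?_⟩
  · have h := hval (-1) isCoprime_one_left.neg_left
    rw [Int.cast_neg, Int.cast_one, Int.cast_neg, Int.cast_one] at h
    exact h.trans (jacobiDirichletChar_odd hΔ)
  · have hsq : χ₀.primitiveCharacter ^ 2 = 1 := by
      apply DirichletCharacter.changeLevel_injective hdvd
      rw [map_pow, hch, map_one, hχ₀, jacobiDirichletChar_sq]
    intro a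
    by_cases ha : IsUnit a
    · obtain ⟨u, rfl⟩ := ha
      have h := congrArg (fun ψ : DirichletCharacter ℂ χ₀.conductor => ψ u) hsq
      simp only [MulChar.pow_apply_coe, MulChar.one_apply_coe] at h
      exact Or.inr (sq_eq_one_iff.mp h)
    · exact Or.inl (MulChar.map_nonunit _ ha)
  · have h := hval n (Nat.isCoprime_iff_coprime.mpr hn)
    rw [Int.cast_natCast, Int.cast_natCast] at h
    exact h.trans (jacobiDirichletChar_apply hn)

section

open Complex HurwitzZeta

lemma ZMod.sum_val_eq_sum_fin {M : Type*} [AddCommMonoid M] {q : ℕ} [NeZero q] (F : ℕ → M) :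
    ∑ a : ZMod q, F a.val = ∑ k : Fin q, F k := by
  cases q with
  | zero => exact absurd rfl (NeZero.ne 0)
  | succ n => rfl

lemma summable_int_mul_exp_neg_sq {b : ℝ} (hb : 0 < b) :
    Summable fun m : ℤ => (m : ℝ) * Real.exp (-Real.pi * m ^ 2 * b) := by
  simpa using (hasSum_int_oddKernel 0 hb).summable

section QuadraticTheta

variable {q : ℕ} [NeZero q] {χ : DirichletCharacter ℂ q}

lemma hasSum_char_mul_oddKernel (χ : DirichletCharacter ℂ q) {x : ℝ} (hx : 0 < x) :
    HasSum (fun m : ℤ => χ m * ((m / q : ℝ) * Real.exp (-Real.pi * (m / q) ^ 2 * x) : ℝ))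
      (∑ a : ZMod q, χ a * oddKernel ((a.val / q : ℝ) : UnitAddCircle) x) := by
  have hq : (0 : ℝ) < q := by exact_mod_cast NeZero.pos q
  have hs : Summable fun m : ℤ =>
      χ m * ((m / q : ℝ) * Real.exp (-Real.pi * (m / q) ^ 2 * x) : ℝ) := by
    refine Summable.of_norm_bounded
      ((summable_int_mul_exp_neg_sq (b := x / q ^ 2) (by positivity)).norm.mul_left (1 / q : ℝ))
      fun m => ?_
    rw [norm_mul]
    refine (mul_le_of_le_one_left (norm_nonneg _) (χ.norm_le_one _)).trans (le_of_eq ?_)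
    rw [Complex.norm_real, norm_mul, norm_mul, norm_div]
    have : -Real.pi * ((m : ℝ) / q) ^ 2 * x = -Real.pi * m ^ 2 * (x / q ^ 2) := by
      field_simp
    rw [this, Real.norm_of_nonneg hq.le]
    ring
  have h (k : Fin q) : HasSum
      (fun n : ℤ => (fun m : ℤ => χ m * ((m / q : ℝ) * Real.exp (-Real.pi * (m / q) ^ 2 * x) : ℝ))
        (((Equiv.prodComm _ _).trans (Int.divModEquiv q).symm) (k, n)))
      (χ (k : ℕ) * oddKernel ((k / q : ℝ) : UnitAddCircle) x) := by
    refine ((hasSum_ofReal.mpr (hasSum_int_oddKernel ((k : ℝ) / q) hx)).mul_left _).congr_fun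
      fun n => ?_
    have h1 : ((n * q + (k : ℕ) : ℤ) : ℝ) / q = n + k / q := by
      push_cast; field_simp
    simp only [Equiv.trans_apply, Equiv.prodComm_apply, Prod.swap, Int.divModEquiv,
      Equiv.coe_fn_symm_mk]
    rw [h1]
    simp
  have e := (((Equiv.prodComm _ _).trans (Int.divModEquiv q).symm).hasSum_iff.mpr
    hs.hasSum).prod_fiberwise h
  have e2 := (hasSum_fintype _).unique e
  have e3 : ∑ a : ZMod q, χ a * oddKernel ((a.val / q : ℝ) : UnitAddCircle) x
      = ∑ a : ZMod q, χ (a.val : ℕ) * oddKernel ((a.val / q : ℝ) : UnitAddCircle) x := by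
    simp
  rw [e3, ZMod.sum_val_eq_sum_fin
    fun k : ℕ => χ k * (oddKernel ((k / q : ℝ) : UnitAddCircle) x : ℂ), e2]
  exact hs.hasSum

lemma hasSum_char_mul_sinKernel (hχ : χ.IsPrimitive) {t : ℝ} (ht : 0 < t) :
    HasSum (fun n : ℤ => -I * n * (χ⁻¹ n * gaussSum χ ZMod.stdAddChar) *
        Real.exp (-Real.pi * n ^ 2 * t))
      (∑ a : ZMod q, χ a * sinKernel ((a.val / q : ℝ) : UnitAddCircle) t) := by
  have h := hasSum_sum (s := Finset.univ) fun (a : ZMod q) _ =>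
    (hasSum_int_sinKernel ((a.val : ℝ) / q) ht).mul_left (χ a)
  refine h.congr_fun fun n => ?_
  rw [← gaussSum_mulShift_of_isPrimitive _ hχ, gaussSum, Finset.mul_sum, Finset.sum_mul]
  refine Finset.sum_congr rfl fun a _ => ?_
  have : ZMod.stdAddChar.mulShift (n : ZMod q) a = cexp (2 * Real.pi * I * (a.val / q : ℝ) * n) := by
    rw [AddChar.mulShift_apply]
    have : (n : ZMod q) * a = ((n * a.val : ℤ) : ZMod q) := by simp
    rw [this, ZMod.stdAddChar_coe]
    congr 1
    push_cast
    ring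
  rw [this]
  ring

/-- The odd theta series `∑ n c(n) exp(-π n² x / q)`. -/
noncomputable def oddTheta (c : ℕ → ℝ) (q : ℕ) (x : ℝ) : ℝ :=
  ∑' n : ℕ, n * c n * Real.exp (-Real.pi * n ^ 2 * x / q)

lemma summable_nat_mul_exp_neg_sq {b : ℝ} (hb : 0 < b) :
    Summable fun n : ℕ => (n : ℝ) * Real.exp (-Real.pi * n ^ 2 * b) := by
  refine ((summable_int_mul_exp_neg_sq hb).comp_injective
    (Nat.cast_injective (R := ℤ))).congr fun n => ?_
  simp

lemma hasSum_int_oddTheta (hodd : χ.Odd) {c : ℕ → ℝ} (hc : ∀ n, (c n : ℂ) = χ n) {x : ℝ}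
    (hx : 0 < x) : HasSum (fun m : ℤ => m * χ m * (Real.exp (-Real.pi * m ^ 2 * x / q) : ℂ))
      (2 * oddTheta c q x) := by
  have hq : (0 : ℝ) < q := by exact_mod_cast NeZero.pos q
  have hs : Summable fun m : ℤ => m * χ m * (Real.exp (-Real.pi * m ^ 2 * x / q) : ℂ) := by
    refine Summable.of_norm_bounded
      (summable_int_mul_exp_neg_sq (b := x / q) (by positivity)).norm fun m => ?_
    rw [norm_mul, norm_mul, norm_mul, Complex.norm_real, Complex.norm_intCast, Real.norm_eq_abs,
      mul_div_assoc]
    gcongr ?_ * _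
    exact mul_le_of_le_one_right (abs_nonneg _) (χ.norm_le_one _)
  have h := hs.hasSum.nat_add_neg
  have hn : HasSum (fun n : ℕ => ((2 * (n * c n * Real.exp (-Real.pi * n ^ 2 * x / q)) : ℝ) : ℂ))
      (∑' m : ℤ, m * χ m * (Real.exp (-Real.pi * m ^ 2 * x / q) : ℂ)) := by
    have h0 : (∑' m : ℤ, m * χ m * (Real.exp (-Real.pi * m ^ 2 * x / q) : ℂ)) = 
      (∑' m : ℤ, m * χ m * (Real.exp (-Real.pi * m ^ 2 * x / q) : ℂ)) + 
        ((0 : ℤ) : ℂ) * χ (0 : ℤ) * (Real.exp (-Real.pi * (0 : ℤ) ^ 2 * x / q) : ℂ) := by simp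
    rw [h0]
    refine h.congr_fun fun n => ?_
    have : χ (-(n : ZMod q)) = - χ n := by rw [hodd.eval_neg]
    push_cast
    rw [this, hc]
    ring_nf
  have e : (∑' m : ℤ, m * χ m * (Real.exp (-Real.pi * m ^ 2 * x / q) : ℂ)) = 2 * oddTheta c q x := by
    rw [← hn.tsum_eq, ← ofReal_tsum, tsum_mul_left, oddTheta]
    push_cast
    rfl
  rw [← e]
  exact hs.hasSum

lemma exists_oddTheta_functional_equation (hχ : χ.IsPrimitive) (hodd : χ.Odd)
    (hquad : χ.IsQuadratic) {c : ℕ → ℝ} (hc : ∀ n, (c n : ℂ) = χ n) :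
    ∃ W : ℝ, ∀ x : ℝ, 0 < x → oddTheta c q (1 / x) = W * x ^ (3 / 2 : ℝ) * oddTheta c q x := by
  have hq : (0 : ℝ) < q := by exact_mod_cast NeZero.pos q
  have hqc : (q : ℂ) ≠ 0 := by exact_mod_cast hq.ne'
  set g := gaussSum χ ZMod.stdAddChar with hg
  refine ⟨(-I * g * q / ((q : ℝ) ^ (3 / 2 : ℝ) : ℝ) : ℂ).re, fun x hx => ?_⟩
  have hx' : 0 < 1 / x := by positivity
  have h1 := hasSum_char_mul_oddKernel χ (x := q * (1 / x)) (by positivity)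
  have h2 : HasSum (fun m : ℤ => χ m * ((m / q : ℝ) *
      Real.exp (-Real.pi * (m / q) ^ 2 * (q * (1 / x))) : ℝ)) (2 * oddTheta c q (1 / x) / q) := by
    refine ((hasSum_int_oddTheta hodd hc hx').div_const (q : ℂ)).congr_fun fun m => ?_
    have : -Real.pi * ((m : ℝ) / q) ^ 2 * (q * (1 / x)) = -Real.pi * m ^ 2 * (1 / x) / q := by
      field_simp
    rw [this]
    push_cast
    ring
  have h3 := hasSum_char_mul_sinKernel hχ (t := x / q) (by positivity)
  have h4 : HasSum (fun n : ℤ => -I * n * (χ⁻¹ n * g) * Real.exp (-Real.pi * n ^ 2 * (x / q)))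
      (-I * g * (2 * oddTheta c q x)) := by
    refine ((hasSum_int_oddTheta hodd hc hx).mul_left (-I * g)).congr_fun fun m => ?_
    rw [hquad.inv, mul_div_assoc]
    ring
  have e : ∑ a : ZMod q, χ a * (oddKernel ((a.val / q : ℝ) : UnitAddCircle) (q * (1 / x)) : ℂ)
      = (1 / (q * (1 / x)) ^ (3 / 2 : ℝ) : ℝ) *
        ∑ a : ZMod q, χ a * (sinKernel ((a.val / q : ℝ) : UnitAddCircle) (x / q) : ℂ) := by
    rw [Finset.mul_sum]
    refine Finset.sum_congr rfl fun a _ => ?_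
    rw [oddKernel_functional_equation]
    have : 1 / (q * (1 / x)) = x / q := by field_simp
    rw [this]
    push_cast
    ring
  rw [h1.unique h2, h3.unique h4] at e
  have e2 : (oddTheta c q (1 / x) : ℂ)
      = (-I * g * q / ((q : ℝ) ^ (3 / 2 : ℝ) : ℝ)) * (x ^ (3 / 2 : ℝ) * oddTheta c q x : ℝ) := by
    have : (q * (1 / x)) ^ (3 / 2 : ℝ) = (q : ℝ) ^ (3 / 2 : ℝ) / x ^ (3 / 2 : ℝ) := by
      rw [mul_one_div, Real.div_rpow hq.le hx.le]
    rw [this, div_eq_iff hqc] at e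
    have e' := congrArg (fun z : ℂ => z / 2) e
    simp only [mul_div_cancel_left₀ _ (two_ne_zero (α := ℂ))] at e'
    rw [e']
    push_cast
    have h5 : ((q : ℝ) ^ (3 / 2 : ℝ) : ℝ) ≠ 0 := by positivity
    have h6 : (x ^ (3 / 2 : ℝ) : ℝ) ≠ 0 := by positivity
    have h5' : (((q : ℝ) ^ (3 / 2 : ℝ) : ℝ) : ℂ) ≠ 0 := by exact_mod_cast h5
    have h6' : ((x ^ (3 / 2 : ℝ) : ℝ) : ℂ) ≠ 0 := by exact_mod_cast h6
    field_simp
  have e3 := congrArg Complex.re e2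
  rw [Complex.re_mul_ofReal, Complex.ofReal_re] at e3
  rw [e3]
  ring

end QuadraticTheta

lemma exists_real_hom {q : ℕ} {χ : DirichletCharacter ℂ q} (hodd : χ.Odd) (hquad : χ.IsQuadratic) :
    ∃ c : ℕ →*₀ ℝ, (∀ n, (c n : ℂ) = χ n) ∧ ∀ n, c n = 0 ∨ c n = 1 ∨ c n = -1 := by
  have h (n : ℕ) : (((χ n).re : ℝ) : ℂ) = χ n := by
    rcases hquad n with h | h | h <;> simp [h]
  have h0 : χ (0 : ZMod q) = 0 := by
    have := DirichletCharacter.Odd.eval_neg χ (0 : ZMod q) hodd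
    rw [neg_zero] at this
    linear_combination this / 2
  refine ⟨⟨⟨fun n => (χ n).re, by simp [h0]⟩, by simp, fun m n => ?_⟩, h, fun n => ?_⟩
  · have : (((χ (m * n : ℕ)).re : ℝ) : ℂ) = (((χ m).re * (χ n).re : ℝ) : ℂ) := by
      rw [ofReal_mul, h, h, h, Nat.cast_mul, map_mul]
    exact_mod_cast this
  · change (χ n).re = 0 ∨ (χ n).re = 1 ∨ (χ n).re = -1
    rcases hquad n with h | h | h <;> simp [h]

lemma exists_quadratic_data {Δ : ℤ} (hΔ : Δ < 0) :
    ∃ (q : ℕ) (c : ℕ →*₀ ℝ) (W : ℝ), 0 < q ∧ q ≤ 4 * Δ.natAbs ∧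
      (∀ n, c n = 0 ∨ c n = 1 ∨ c n = -1) ∧
      (∀ n : ℕ, n.Coprime (4 * Δ.natAbs) → c n = jacobiSym Δ n) ∧
      ∀ x : ℝ, 0 < x → oddTheta c q (1 / x) = W * x ^ (3 / 2 : ℝ) * oddTheta c q x := by
  obtain ⟨q, χ, hprim, hodd, hquad, hdvd, hval⟩ := exists_primitive_quadratic_char hΔ
  have hq : 0 < q := Nat.pos_of_dvd_of_pos hdvd (by omega)
  have : NeZero q := ⟨hq.ne'⟩
  obtain ⟨c, hc, hc1⟩ := exists_real_hom hodd hquad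
  obtain ⟨W, hW⟩ := exists_oddTheta_functional_equation hprim hodd hquad hc
  refine ⟨q, c, W, hq, Nat.le_of_dvd (by omega) hdvd, hc1, fun n hn => ?_, hW⟩
  have := (hc n).trans (hval n hn)
  exact_mod_cast this

end

section

open MeasureTheory Set

section CauchySchlomilch

variable {a b : ℝ}

lemma image_mul_sub_div_Ioi (ha : 0 < a) (hb : 0 < b) :
    (fun y : ℝ => b * y - a / y) '' Ioi 0 = univ := by
  refine eq_univ_of_forall fun v => ?_
  have hD : 0 ≤ v ^ 2 + 4 * a * b := by positivity
  have hs := Real.sq_sqrt hD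
  have hlt : |v| < √(v ^ 2 + 4 * a * b) := by
    rw [← Real.sqrt_sq_eq_abs]
    exact Real.sqrt_lt_sqrt (sq_nonneg v) (by nlinarith [mul_pos ha hb])
  have hpos : 0 < v + √(v ^ 2 + 4 * a * b) := by linarith [neg_abs_le v]
  refine ⟨(v + √(v ^ 2 + 4 * a * b)) / (2 * b), mem_Ioi.mpr (by positivity), ?_⟩
  set r := √(v ^ 2 + 4 * a * b)
  have h0 : v + r ≠ 0 := hpos.ne'
  simp only
  field_simp
  linear_combination hs

lemma hasDerivAt_mul_sub_div {y : ℝ} (hy : 0 < y) :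
    HasDerivAt (fun y : ℝ => b * y - a / y) (b + a / y ^ 2) y := by
  have h := ((hasDerivAt_id y).const_mul b).sub ((hasDerivAt_inv hy.ne').const_mul a)
  convert! h using 1
  · field_simp
    ring

lemma injOn_mul_sub_div (ha : 0 < a) (hb : 0 < b) :
    InjOn (fun y : ℝ => b * y - a / y) (Ioi 0) := by
  refine StrictMonoOn.injOn fun x hx y hy hxy => ?_
  have hx : 0 < x := hx
  have : a / y < a / x := div_lt_div_of_pos_left ha hx hxy
  have : b * x < b * y := by gcongr
  linarith

lemma integrableOn_exp_neg_sq_mul_sub_div (ha : 0 < a) (hb : 0 < b) :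
    IntegrableOn (fun y : ℝ => (b + a / y ^ 2) * Real.exp (-(b * y - a / y) ^ 2)) (Ioi 0) := by
  have h := (integrableOn_image_iff_integrableOn_abs_deriv_smul measurableSet_Ioi
    (fun y (hy : y ∈ Ioi (0 : ℝ)) => (hasDerivAt_mul_sub_div (a := a) (b := b) hy).hasDerivWithinAt)
    (injOn_mul_sub_div ha hb) (fun v => Real.exp (-1 * v ^ 2))).mp (by
      rw [image_mul_sub_div_Ioi ha hb]
      exact (integrable_exp_neg_mul_sq one_pos).integrableOn)
  refine h.congr_fun (fun y hy => ?_) measurableSet_Ioi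
  have hy : 0 < y := hy
  simp only [smul_eq_mul, neg_one_mul]
  rw [abs_of_pos (by positivity)]

lemma integral_exp_neg_sq_mul_sub_div (ha : 0 < a) (hb : 0 < b) :
    IntegrableOn (fun y : ℝ => Real.exp (-(b * y - a / y) ^ 2)) (Ioi 0) ∧
    ∫ y in Ioi (0 : ℝ), Real.exp (-(b * y - a / y) ^ 2) = √Real.pi / (2 * b) := by
  have hint := integrableOn_exp_neg_sq_mul_sub_div ha hb
  have h1 : IntegrableOn (fun y : ℝ => Real.exp (-(b * y - a / y) ^ 2)) (Ioi 0) := by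
    refine Integrable.mono' (hint.const_mul b⁻¹) ?_ ?_
    · exact Measurable.aestronglyMeasurable (by fun_prop)
    · refine (ae_restrict_mem measurableSet_Ioi).mono fun y hy => ?_
      have hy : 0 < y := hy
      rw [Real.norm_of_nonneg (Real.exp_pos _).le, ← mul_assoc]
      refine le_mul_of_one_le_left (Real.exp_pos _).le ?_
      rw [mul_add, inv_mul_cancel₀ hb.ne']
      have : 0 ≤ b⁻¹ * (a / y ^ 2) := by positivity
      linarith
  refine ⟨h1, ?_⟩
  have h2 : ∫ y in Ioi (0 : ℝ), (b + a / y ^ 2) * Real.exp (-(b * y - a / y) ^ 2) = √Real.pi := by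
    have h := integral_image_eq_integral_abs_deriv_smul measurableSet_Ioi
      (fun y (hy : y ∈ Ioi (0 : ℝ)) =>
        (hasDerivAt_mul_sub_div (a := a) (b := b) hy).hasDerivWithinAt)
      (injOn_mul_sub_div ha hb) (fun v => Real.exp (-1 * v ^ 2))
    rw [image_mul_sub_div_Ioi ha hb, setIntegral_univ, integral_gaussian, div_one] at h
    rw [h]
    refine setIntegral_congr_fun measurableSet_Ioi fun y hy => ?_
    have hy : 0 < y := hy
    simp only [smul_eq_mul, neg_one_mul]
    rw [abs_of_pos (by positivity)]
  have h3 : ∫ y in Ioi (0 : ℝ), Real.exp (-(b * y - a / y) ^ 2)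
      = ∫ y in Ioi (0 : ℝ), (a / (b * y ^ 2)) * Real.exp (-(b * y - a / y) ^ 2) := by
    have himg : (fun y : ℝ => a / b * y⁻¹) '' Ioi 0 = Ioi 0 := by
      ext x
      constructor
      · rintro ⟨y, hy, rfl⟩
        have hy : 0 < y := hy
        exact mem_Ioi.mpr (by positivity)
      · intro hx
        have hx : 0 < x := hx
        exact ⟨a / b * x⁻¹, mem_Ioi.mpr (by positivity), by field_simp⟩
    have h := integral_image_eq_integral_abs_deriv_smul measurableSet_Ioi
      (fun y (hy : y ∈ Ioi (0 : ℝ)) =>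
        ((hasDerivAt_inv (ne_of_gt hy)).const_mul (a / b)).hasDerivWithinAt)
      (fun x hx y hy hxy => by
        have hx : 0 < x := hx
        have hy : 0 < y := hy
        exact inv_injective (mul_left_cancel₀ (by positivity) hxy))
      (fun y : ℝ => Real.exp (-(b * y - a / y) ^ 2))
    rw [himg] at h
    rw [h]
    refine setIntegral_congr_fun measurableSet_Ioi fun y hy => ?_
    have hy : 0 < y := hy
    simp only [smul_eq_mul]
    rw [mul_neg, abs_neg, abs_of_pos (by positivity)]
    congr 1
    · field_simp
    · congr 1
      field_simp
      ring
  have h4 : √Real.pi = b * (∫ y in Ioi (0 : ℝ), Real.exp (-(b * y - a / y) ^ 2))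
      + b * ∫ y in Ioi (0 : ℝ), (a / (b * y ^ 2)) * Real.exp (-(b * y - a / y) ^ 2) := by
    rw [← h2, ← integral_const_mul, ← integral_const_mul, ← integral_add (h1.const_mul b)]
    · refine setIntegral_congr_fun measurableSet_Ioi fun y hy => ?_
      have hy : 0 < y := hy
      field_simp
    · refine (hint.sub (h1.const_mul b)).congr_fun (fun y hy => ?_) measurableSet_Ioi
      have hy : 0 < y := hy
      simp only [Pi.sub_apply]
      field_simp
      ring
  rw [← h3] at h4
  rw [h4]
  field_simp
  ring

lemma integral_rpow_mul_exp_neg_sub_div (ha : 0 < a) (hb : 0 < b) :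
    IntegrableOn (fun x : ℝ => x ^ (-3 / 2 : ℝ) * Real.exp (-a ^ 2 * x - b ^ 2 / x)) (Ioi 0) ∧
    ∫ x in Ioi (0 : ℝ), x ^ (-3 / 2 : ℝ) * Real.exp (-a ^ 2 * x - b ^ 2 / x)
      = √Real.pi / b * Real.exp (-2 * a * b) := by
  obtain ⟨h1, h2⟩ := integral_exp_neg_sq_mul_sub_div ha hb
  have key (x : ℝ) (hx : 0 < x) : x ^ (-3 / 2 : ℝ) * Real.exp (-a ^ 2 * x - b ^ 2 / x)
      = (2 * Real.exp (-2 * a * b)) * ((|(-1 / 2 : ℝ)| * x ^ ((-1 / 2 : ℝ) - 1)) •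
        Real.exp (-(b * x ^ (-1 / 2 : ℝ) - a / x ^ (-1 / 2 : ℝ)) ^ 2)) := by
    have hs : (x ^ (-1 / 2 : ℝ)) ^ 2 = 1 / x := by
      rw [← Real.rpow_natCast, ← Real.rpow_mul hx.le]
      norm_num [Real.rpow_neg_one]
    have hp : 0 < x ^ (-1 / 2 : ℝ) := by positivity
    have e1 : -(b * x ^ (-1 / 2 : ℝ) - a / x ^ (-1 / 2 : ℝ)) ^ 2
        = -a ^ 2 * x - b ^ 2 / x + 2 * a * b := by
      have : (b * x ^ (-1 / 2 : ℝ) - a / x ^ (-1 / 2 : ℝ)) ^ 2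
          = b ^ 2 * (x ^ (-1 / 2 : ℝ)) ^ 2 + a ^ 2 / (x ^ (-1 / 2 : ℝ)) ^ 2 - 2 * a * b := by
        field_simp
        ring
      rw [this, hs]
      field_simp
      ring
    rw [e1, show (-1 / 2 : ℝ) - 1 = -3 / 2 by norm_num, smul_eq_mul, abs_of_neg (by norm_num)]
    rw [Real.exp_add]
    have : Real.exp (-2 * a * b) * Real.exp (2 * a * b) = 1 := by
      rw [← Real.exp_add]; simp
    linear_combination (-x ^ (-3 / 2 : ℝ) * Real.exp (-a ^ 2 * x - b ^ 2 / x)) * this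
  constructor
  · have := (integrableOn_Ioi_comp_rpow_iff
      (fun y : ℝ => Real.exp (-(b * y - a / y) ^ 2)) (p := -1 / 2) (by norm_num)).mpr h1
    exact IntegrableOn.congr_fun (this.const_mul (2 * Real.exp (-2 * a * b)))
      (fun x hx => (key x hx).symm) measurableSet_Ioi
  · rw [setIntegral_congr_fun measurableSet_Ioi key, integral_const_mul,
      integral_comp_rpow_Ioi (fun y : ℝ => Real.exp (-(b * y - a / y) ^ 2)) (by norm_num), h2]
    ring

end CauchySchlomilch

end

section

open MeasureTheory Set

lemma integrable_tsum_of_summable_integral_norm {α ι : Type*} [Countable ι] [MeasurableSpace α]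
    {μ : Measure α} {f : ι → α → ℝ} (hf : ∀ i, Integrable (f i) μ)
    (hs : Summable fun i => ∫ a, ‖f i a‖ ∂μ) (hpt : ∀ᵐ a ∂μ, Summable fun i => f i a) :
    Integrable (fun a => ∑' i, f i a) μ := by
  refine ⟨aestronglyMeasurable_of_tendsto_ae (u := Filter.atTop)
    (f := fun (s : Finset ι) a => ∑ i ∈ s, f i a)
    (fun s => Finset.aestronglyMeasurable_fun_sum s fun i _ => (hf i).1)
    (hpt.mono fun a ha => ha.hasSum), ?_⟩
  have h1 : ∫⁻ a, ‖∑' i, f i a‖ₑ ∂μ ≤ ∫⁻ a, ∑' i, ‖f i a‖ₑ ∂μ := by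
    refine lintegral_mono_ae (hpt.mono fun a ha => ?_)
    exact enorm_tsum_le_tsum_enorm
  rw [lintegral_tsum fun i => (hf i).1.enorm] at h1
  refine lt_of_le_of_lt h1 ?_
  have h2 (i : ι) : ∫⁻ a, ‖f i a‖ₑ ∂μ = ENNReal.ofReal (∫ a, ‖f i a‖ ∂μ) := by
    rw [ofReal_integral_norm_eq_lintegral_enorm (hf i)]
  simp only [h2]
  exact hs.tsum_ofReal_lt_top

lemma hasSum_pnat_of_hasSum_nat {f : ℕ → ℝ} {S : ℝ} (h0 : f 0 = 0) (h : HasSum f S) :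
    HasSum (fun n : ℕ+ => f n) S := by
  refine (PNat.coe_injective.hasSum_iff fun n hn => ?_).mpr h
  rcases Nat.eq_zero_or_pos n with rfl | hn0
  · exact h0
  · exact absurd ⟨⟨n, hn0⟩, rfl⟩ hn

/-- The sum of `exp(-π k² x)` over positive integers `k`. -/
noncomputable def jacobiPsi (x : ℝ) : ℝ := ∑' k : ℕ+, Real.exp (-Real.pi * k ^ 2 * x)

lemma summable_int_exp_neg_sq {x : ℝ} (hx : 0 < x) :
    Summable fun k : ℤ => Real.exp (-Real.pi * k ^ 2 * x) := by
  have h := (HurwitzZeta.hasSum_int_evenKernel 0 hx).summable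
  simpa using h

lemma summable_exp_neg_sq {x : ℝ} (hx : 0 < x) :
    Summable fun k : ℕ+ => Real.exp (-Real.pi * k ^ 2 * x) := by
  refine ((summable_int_exp_neg_sq hx).comp_injective
    (Nat.cast_injective.comp PNat.coe_injective)).congr fun k => ?_
  simp

lemma tsum_int_exp_neg_sq {x : ℝ} (hx : 0 < x) :
    ∑' k : ℤ, Real.exp (-Real.pi * k ^ 2 * x) = 1 + 2 * jacobiPsi x := by
  rw [tsum_int_eq_zero_add_two_mul_tsum_pnat (fun n => by simp) (summable_int_exp_neg_sq hx)]
  simp [jacobiPsi]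

lemma jacobiPsi_functional_equation {x : ℝ} (hx : 0 < x) :
    1 + 2 * jacobiPsi (1 / x) = x ^ (1 / 2 : ℝ) * (1 + 2 * jacobiPsi x) := by
  have h := Real.tsum_exp_neg_mul_int_sq hx
  rw [← tsum_int_exp_neg_sq hx, ← tsum_int_exp_neg_sq (by positivity)]
  have e1 (k : ℤ) : -Real.pi * x * (k : ℝ) ^ 2 = -Real.pi * k ^ 2 * x := by ring
  have e2 (k : ℤ) : -Real.pi / x * (k : ℝ) ^ 2 = -Real.pi * k ^ 2 * (1 / x) := by ring
  simp only [e1, e2] at h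
  rw [h, ← mul_assoc, mul_one_div_cancel (by positivity), one_mul]

/-- The Lambert type series `∑ c(d) exp(-κ m d)` over positive integers `m` and `d`. -/
noncomputable def lambertSum (c : ℕ → ℝ) (κ : ℝ) : ℝ :=
  ∑' x : ℕ+ × ℕ+, c x.2 * Real.exp (-κ * (x.1 * x.2))

lemma summable_exp_neg_mul_mul {κ : ℝ} (hκ : 0 < κ) :
    Summable fun x : ℕ+ × ℕ+ => Real.exp (-κ * (x.1 * x.2)) := by
  refine (summable_prod_mul_pow (𝕜 := ℝ) 0 (r := Real.exp (-κ)) ?_).congr fun x => ?_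
  · rw [Real.norm_of_nonneg (Real.exp_pos _).le]
    exact Real.exp_lt_one_iff.mpr (by linarith)
  · rw [pow_zero, one_mul, ← Real.exp_nat_mul]
    push_cast
    ring_nf

variable {c : ℕ → ℝ} {q : ℕ} {W : ℝ}

lemma summable_oddTheta (hc : ∀ n, |c n| ≤ 1) (hq : 0 < q) {x : ℝ} (hx : 0 < x) :
    Summable fun n : ℕ => ‖n * c n * Real.exp (-Real.pi * n ^ 2 * x / q)‖ := by
  refine Summable.of_nonneg_of_le (fun _ => norm_nonneg _) (fun n => ?_)
    (summable_nat_mul_exp_neg_sq (b := x / q) (by positivity))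
  rw [norm_mul, norm_mul, Real.norm_natCast, Real.norm_of_nonneg (Real.exp_pos _).le, mul_div_assoc]
  gcongr
  exact mul_le_of_le_one_right (Nat.cast_nonneg _) (hc n)

lemma oddTheta_eq_tsum_pnat (hc : ∀ n, |c n| ≤ 1) (hq : 0 < q) {x : ℝ} (hx : 0 < x) :
    HasSum (fun n : ℕ+ => n * c n * Real.exp (-Real.pi * n ^ 2 * x / q)) (oddTheta c q x) :=
  hasSum_pnat_of_hasSum_nat (f := fun n : ℕ => n * c n * Real.exp (-Real.pi * n ^ 2 * x / q))
    (by simp) (summable_oddTheta hc hq hx).of_norm.hasSum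

lemma integrableOn_oddTheta_Ioi_one (hc : ∀ n, |c n| ≤ 1) (hq : 0 < q) :
    IntegrableOn (oddTheta c q) (Ioi 1) := by
  have hq' : (0 : ℝ) < q := by exact_mod_cast hq
  have hb (n : ℕ+) : -(Real.pi * n ^ 2 / q) < 0 := neg_lt_zero.mpr (by positivity)
  have e (n : ℕ+) (x : ℝ) : -Real.pi * n ^ 2 * x / q = -(Real.pi * n ^ 2 / q) * x := by ring
  have hint (n : ℕ+) : IntegrableOn
      (fun x => n * c n * Real.exp (-Real.pi * n ^ 2 * x / q)) (Ioi 1) := by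
    simp only [e]
    exact (integrableOn_exp_mul_Ioi (hb n) 1).const_mul _
  have h := integrable_tsum_of_summable_integral_norm hint ?_ ?_
  · refine IntegrableOn.congr_fun h (fun x hx => ?_) measurableSet_Ioi
    exact (oddTheta_eq_tsum_pnat hc hq (zero_lt_one.trans hx)).tsum_eq
  · have hs := ((summable_nat_mul_exp_neg_sq (b := 1 / q) (by positivity)).comp_injective
      PNat.coe_injective).mul_left (q / Real.pi)
    refine Summable.of_nonneg_of_le (fun n => by positivity) (fun n => ?_) hs
    have hn : (1 : ℝ) ≤ n := by exact_mod_cast n.2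
    simp only [norm_mul, e, Real.norm_of_nonneg (Real.exp_pos _).le, Real.norm_natCast]
    rw [integral_const_mul, integral_exp_mul_Ioi (hb n) 1]
    calc (n : ℝ) * ‖c n‖ * (-Real.exp (-(Real.pi * n ^ 2 / q) * 1) / -(Real.pi * n ^ 2 / q))
        ≤ n * 1 * (-Real.exp (-(Real.pi * n ^ 2 / q) * 1) / -(Real.pi * n ^ 2 / q)) := by
          rw [neg_div_neg_eq]
          gcongr
          exact hc n
      _ = (q / Real.pi) * (Real.exp (-Real.pi * n ^ 2 * (1 / q)) / n) := by
          rw [neg_div_neg_eq]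
          have : -(Real.pi * (n : ℝ) ^ 2 / q) * 1 = -Real.pi * n ^ 2 * (1 / q) := by ring
          rw [this]
          field_simp
      _ ≤ _ := by
          simp only [Function.comp_apply]
          gcongr
          rw [div_le_iff₀ (by positivity)]
          nlinarith [Real.exp_pos (-Real.pi * (n : ℝ) ^ 2 * (1 / q)),
            mul_le_mul hn hn zero_le_one (by positivity)]
  · refine (ae_restrict_mem measurableSet_Ioi).mono fun x hx => ?_
    exact (oddTheta_eq_tsum_pnat hc hq (zero_lt_one.trans hx)).summable

lemma integrableOn_rpow_mul_oddTheta (hc : ∀ n, |c n| ≤ 1) (hq : 0 < q)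
    (hW : ∀ x : ℝ, 0 < x → oddTheta c q (1 / x) = W * x ^ (3 / 2 : ℝ) * oddTheta c q x) :
    IntegrableOn (fun x => x ^ (-1 / 2 : ℝ) * oddTheta c q x) (Ioi 0) := by
  have h1 := integrableOn_oddTheta_Ioi_one hc hq
  have h2 : IntegrableOn ((Ioi (1 : ℝ)).indicator (oddTheta c q)) (Ioi 0) :=
    ((integrable_indicator_iff measurableSet_Ioi).mpr h1).integrableOn
  have h3 := (integrableOn_Ioi_comp_rpow_iff' _ (p := -1) (by norm_num)).mpr h2
  have h4 : IntegrableOn (fun x => x ^ (-1 / 2 : ℝ) * oddTheta c q x) (Ioi 1) := by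
    refine Integrable.mono h1 ?_ ((ae_restrict_mem measurableSet_Ioi).mono fun x hx => ?_)
    · exact (Measurable.aestronglyMeasurable (by fun_prop)).mul h1.1
    · have hx : (1 : ℝ) < x := hx
      rw [norm_mul, Real.norm_of_nonneg (by positivity)]
      exact mul_le_of_le_one_left (norm_nonneg _)
        (Real.rpow_le_one_of_one_le_of_nonpos hx.le (by norm_num))
  have h5 : IntegrableOn (fun x => x ^ (-1 / 2 : ℝ) * oddTheta c q x) (Ioo 0 1) := by
    refine IntegrableOn.congr_fun ((h3.mono_set Ioo_subset_Ioi_self).const_mul W) (fun x hx => ?_)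
      measurableSet_Ioo
    have hx0 : 0 < x := hx.1
    have hx1 : 1 < x⁻¹ := (one_lt_inv₀ hx0).mpr hx.2
    have e := hW (1 / x) (by positivity)
    rw [one_div_one_div] at e
    simp only [Real.rpow_neg_one, smul_eq_mul]
    rw [indicator_of_mem (mem_Ioi.mpr hx1), e, one_div, Real.inv_rpow hx0.le,
      ← Real.rpow_neg hx0.le, show (-1 - 1 : ℝ) = -1 / 2 + -(3 / 2) by norm_num,
      Real.rpow_add hx0]
    ring
  have h6 := h5.union (integrableOn_singleton (x := (1 : ℝ))
    (f := fun x => x ^ (-1 / 2 : ℝ) * oddTheta c q x) (μ := volume) (hx := by simp)) |>.union h4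
  refine h6.mono_set fun x hx => ?_
  rcases lt_trichotomy x 1 with h | h | h
  · exact Or.inl (Or.inl ⟨hx, h⟩)
  · exact Or.inl (Or.inr h)
  · exact Or.inr h

end

section

open MeasureTheory Set

variable {c : ℕ → ℝ} {q : ℕ} {W : ℝ}

lemma jacobiPsi_mul_oddTheta (hc : ∀ n, |c n| ≤ 1) (hq : 0 < q) {x y : ℝ} (hx : 0 < x)
    (hy : 0 < y) :
    HasSum (fun z : ℕ+ × ℕ+ => Real.exp (-Real.pi * z.1 ^ 2 * x) *
      (z.2 * c z.2 * Real.exp (-Real.pi * z.2 ^ 2 * y / q)))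
      (jacobiPsi x * oddTheta c q y) := by
  have h1 := summable_exp_neg_sq hx
  have h2 := oddTheta_eq_tsum_pnat hc hq hy
  have h3 : Summable fun n : ℕ+ => ‖n * c n * Real.exp (-Real.pi * n ^ 2 * y / q)‖ :=
    (summable_oddTheta hc hq hy).comp_injective PNat.coe_injective
  have h4 : Summable fun n : ℕ+ => ‖Real.exp (-Real.pi * n ^ 2 * x)‖ := by
    simpa only [Real.norm_of_nonneg (Real.exp_pos _).le] using h1
  have h5 := (summable_mul_of_summable_norm h4 h3).hasSum
  rwa [← tsum_mul_tsum_of_summable_norm h4 h3, h2.tsum_eq] at h5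

lemma integral_rpow_mul_jacobiPsi_mul_oddTheta (hc : ∀ n, |c n| ≤ 1) (hq : 0 < q) {t : ℝ}
    (ht : 0 < t) :
    IntegrableOn (fun x => x ^ (-3 / 2 : ℝ) * (jacobiPsi (t * x) * oddTheta c q (t / x))) (Ioi 0) ∧
    ∫ x in Ioi 0, x ^ (-3 / 2 : ℝ) * (jacobiPsi (t * x) * oddTheta c q (t / x)) =
      √q / √t * lambertSum c (2 * Real.pi * t / √q) := by
  have hq' : (0 : ℝ) < q := by exact_mod_cast hq
  set a : ℕ+ → ℝ := fun m => √(Real.pi * t) * m with ha_def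
  set b : ℕ+ → ℝ := fun d => √(Real.pi * t / q) * d with hb_def
  have ha (m : ℕ+) : 0 < a m := by positivity
  have hb (m : ℕ+) : 0 < b m := by positivity
  have ha2 (m : ℕ+) : a m ^ 2 = Real.pi * t * m ^ 2 := by
    rw [ha_def, mul_pow, Real.sq_sqrt (by positivity)]
  have hb2 (m : ℕ+) : b m ^ 2 = Real.pi * t / q * m ^ 2 := by
    rw [hb_def, mul_pow, Real.sq_sqrt (by positivity)]
  have hab (m d : ℕ+) : -2 * a m * b d = -(2 * Real.pi * t / √q) * (m * d) := by
    have : √(Real.pi * t / q) = √(Real.pi * t) / √q := Real.sqrt_div (by positivity) _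
    simp only [ha_def, hb_def, this]
    field_simp
    rw [Real.sq_sqrt (by positivity)]
  have hbd (d : ℕ+) : d * (√Real.pi / b d) = √q / √t := by
    have : √(Real.pi * t / q) = √Real.pi * √t / √q := by
      rw [Real.sqrt_div (by positivity), Real.sqrt_mul (by positivity)]
    simp only [hb_def, this]
    field_simp
  let F : ℕ+ × ℕ+ → ℝ → ℝ := fun z x => z.2 * c z.2 *
    (x ^ (-3 / 2 : ℝ) * Real.exp (-a z.1 ^ 2 * x - b z.2 ^ 2 / x))
  have hF (z) : IntegrableOn (F z) (Ioi 0) :=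
    (integral_rpow_mul_exp_neg_sub_div (ha z.1) (hb z.2)).1.const_mul _
  have hFi (z) : ∫ x in Ioi 0, F z x =
      √q / √t * (c z.2 * Real.exp (-(2 * Real.pi * t / √q) * (z.1 * z.2))) := by
    simp only [F]
    rw [integral_const_mul, (integral_rpow_mul_exp_neg_sub_div (ha z.1) (hb z.2)).2, hab, ← hbd z.2]
    ring
  have hFn (z) : ∫ x in Ioi 0, ‖F z x‖ =
      √q / √t * (|c z.2| * Real.exp (-(2 * Real.pi * t / √q) * (z.1 * z.2))) := by
    have : ∀ x ∈ Ioi (0 : ℝ), ‖F z x‖ = z.2 * |c z.2| *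
        (x ^ (-3 / 2 : ℝ) * Real.exp (-a z.1 ^ 2 * x - b z.2 ^ 2 / x)) := fun x hx => by
      have hx : 0 < x := hx
      simp only [F]
      rw [norm_mul, norm_mul, Real.norm_natCast, Real.norm_eq_abs,
        Real.norm_of_nonneg (by positivity)]
    rw [setIntegral_congr_fun measurableSet_Ioi this, integral_const_mul,
      (integral_rpow_mul_exp_neg_sub_div (ha z.1) (hb z.2)).2, hab, ← hbd z.2]
    ring
  have hsum := summable_exp_neg_mul_mul (κ := 2 * Real.pi * t / √q) (by positivity)
  have hs : Summable fun z => ∫ x in Ioi 0, ‖F z x‖ := by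
    simp only [hFn]
    refine Summable.mul_left _ (Summable.of_nonneg_of_le (fun z => by positivity) (fun z => ?_) hsum)
    exact mul_le_of_le_one_left (Real.exp_pos _).le (hc _)
  have hpt (x : ℝ) (hx : 0 < x) : HasSum (fun z => F z x)
      (x ^ (-3 / 2 : ℝ) * (jacobiPsi (t * x) * oddTheta c q (t / x))) := by
    refine ((jacobiPsi_mul_oddTheta hc hq (mul_pos ht hx) (div_pos ht hx)).mul_left
      (x ^ (-3 / 2 : ℝ))).congr_fun fun z => ?_
    simp only [F]
    rw [sub_eq_add_neg, Real.exp_add, ha2, hb2]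
    have e1 : -(Real.pi * t * (z.1 : ℝ) ^ 2) * x = -Real.pi * z.1 ^ 2 * (t * x) := by ring
    have e2 : -(Real.pi * t / q * (z.2 : ℝ) ^ 2 / x) = -Real.pi * z.2 ^ 2 * (t / x) / q := by ring
    rw [e1, e2]
    ring
  constructor
  · refine IntegrableOn.congr_fun (integrable_tsum_of_summable_integral_norm hF hs ?_)
      (fun x hx => (hpt x hx).tsum_eq) measurableSet_Ioi
    exact (ae_restrict_mem measurableSet_Ioi).mono fun x hx => (hpt x hx).summable
  · have h := hasSum_integral_of_summable_integral_norm hF hs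
    rw [setIntegral_congr_fun measurableSet_Ioi fun x hx => (hpt x hx).tsum_eq] at h
    rw [← h.tsum_eq]
    simp only [hFi]
    rw [tsum_mul_left, lambertSum]

lemma integral_rpow_mul_oddTheta_div {t : ℝ} (ht : 0 < t)
    (hB : IntegrableOn (fun x => x ^ (-1 / 2 : ℝ) * oddTheta c q x) (Ioi 0)) :
    IntegrableOn (fun x => x ^ (-3 / 2 : ℝ) * oddTheta c q (t / x)) (Ioi 0) ∧
    ∫ x in Ioi 0, x ^ (-3 / 2 : ℝ) * oddTheta c q (t / x) =
      (∫ x in Ioi 0, x ^ (-1 / 2 : ℝ) * oddTheta c q x) / √t := by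
  let g : ℝ → ℝ := fun y => t ^ (1 / 2 : ℝ) * ((t * y) ^ (-1 / 2 : ℝ) * oddTheta c q (t * y))
  have hg : IntegrableOn g (Ioi 0) := by
    have := (integrableOn_Ioi_comp_mul_left_iff (fun x => x ^ (-1 / 2 : ℝ) * oddTheta c q x) 0
      ht).mpr (by simpa using hB)
    exact this.const_mul _
  have hgi : ∫ x in Ioi 0, g x = (∫ x in Ioi 0, x ^ (-1 / 2 : ℝ) * oddTheta c q x) / √t := by
    have := integral_comp_mul_left_Ioi (fun x => x ^ (-1 / 2 : ℝ) * oddTheta c q x) 0 ht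
    simp only [g]
    rw [integral_const_mul, this, mul_zero, smul_eq_mul, ← Real.sqrt_eq_rpow]
    field_simp
    rw [Real.sq_sqrt ht.le]
  have key : ∀ x ∈ Ioi (0 : ℝ), (|(-1 : ℝ)| * x ^ (-1 - 1 : ℝ)) • g (x ^ (-1 : ℝ)) =
      x ^ (-3 / 2 : ℝ) * oddTheta c q (t / x) := fun x hx => by
    have hx : 0 < x := hx
    simp only [g, Real.rpow_neg_one, smul_eq_mul, abs_neg, abs_one, one_mul]
    have e : x ^ (-3 / 2 : ℝ) = x ^ (-1 - 1 : ℝ) / x ^ (-1 / 2 : ℝ) := by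
      rw [← Real.rpow_sub hx]; norm_num
    rw [← div_eq_mul_inv, Real.div_rpow ht.le hx.le, e]
    have : t ^ (1 / 2 : ℝ) * t ^ (-1 / 2 : ℝ) = 1 := by
      rw [← Real.rpow_add ht]; norm_num
    linear_combination x ^ (-1 - 1 : ℝ) / x ^ (-1 / 2 : ℝ) * oddTheta c q (t / x) * this
  constructor
  · exact IntegrableOn.congr_fun ((integrableOn_Ioi_comp_rpow_iff g (p := -1) (by norm_num)).mpr hg)
      key measurableSet_Ioi
  · rw [← hgi, ← integral_comp_rpow_Ioi g (p := -1) (by norm_num)]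
    exact (setIntegral_congr_fun measurableSet_Ioi key).symm

/-- The functional equation `a + T(1/t) = W t (a + T(t))` of the Lambert series of a character. -/
lemma exists_lambertSum_functional_equation (hc : ∀ n, |c n| ≤ 1) (hq : 0 < q)
    (hW : ∀ x : ℝ, 0 < x → oddTheta c q (1 / x) = W * x ^ (3 / 2 : ℝ) * oddTheta c q x) :
    ∃ a : ℝ, ∀ t : ℝ, 0 < t → a + lambertSum c (2 * Real.pi * (1 / t) / √q) =
      W * t * (a + lambertSum c (2 * Real.pi * t / √q)) := by
  have hq' : (0 : ℝ) < q := by exact_mod_cast hq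
  have hBint := integrableOn_rpow_mul_oddTheta hc hq hW
  set B := ∫ x in Ioi 0, x ^ (-1 / 2 : ℝ) * oddTheta c q x with hB
  let f : ℝ → ℝ → ℝ := fun t x =>
    x ^ (-3 / 2 : ℝ) * ((1 + 2 * jacobiPsi (t * x)) * oddTheta c q (t / x))
  have hI (t : ℝ) (ht : 0 < t) : ∫ x in Ioi 0, f t x =
      2 * √q / √t * (B / (2 * √q) + lambertSum c (2 * Real.pi * t / √q)) := by
    have h1 := integral_rpow_mul_oddTheta_div ht hBint
    have h2 := integral_rpow_mul_jacobiPsi_mul_oddTheta hc hq ht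
    have e (x : ℝ) : f t x = x ^ (-3 / 2 : ℝ) * oddTheta c q (t / x) +
        2 * (x ^ (-3 / 2 : ℝ) * (jacobiPsi (t * x) * oddTheta c q (t / x))) := by
      simp only [f]
      ring
    simp only [e]
    rw [integral_add h1.1 (h2.1.const_mul 2), integral_const_mul, h1.2, h2.2, ← hB]
    field_simp
  refine ⟨B / (2 * √q), fun t ht => ?_⟩
  have hsymm : ∫ x in Ioi 0, f (1 / t) x = W * t ^ 2 * ∫ x in Ioi 0, f t x := by
    rw [← integral_comp_rpow_Ioi (f (1 / t)) (p := -1) (by norm_num), ← integral_const_mul]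
    refine setIntegral_congr_fun measurableSet_Ioi fun x hx => ?_
    have hx : 0 < x := hx
    simp only [f, Real.rpow_neg_one, smul_eq_mul, abs_neg, abs_one, one_mul]
    have e1 : 1 / t * x⁻¹ = 1 / (t * x) := by field_simp
    have e2 : 1 / t / x⁻¹ = 1 / (t / x) := by field_simp
    rw [e1, e2, jacobiPsi_functional_equation (by positivity), hW _ (by positivity),
      Real.mul_rpow ht.le hx.le, Real.div_rpow ht.le hx.le, Real.inv_rpow hx.le,
      ← Real.rpow_neg hx.le]
    have e3 : t ^ (1 / 2 : ℝ) * t ^ (3 / 2 : ℝ) = t ^ 2 := by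
      rw [← Real.rpow_add ht]; norm_num
    have e4 : x ^ (-1 - 1 : ℝ) * x ^ (-(-3 / 2) : ℝ) * x ^ (1 / 2 : ℝ) / x ^ (3 / 2 : ℝ) =
        x ^ (-3 / 2 : ℝ) := by
      rw [← Real.rpow_add hx, ← Real.rpow_add hx, ← Real.rpow_sub hx]; norm_num
    rw [← e3, ← e4]
    ring
  rw [hI _ ht, hI _ (by positivity)] at hsymm
  have hs : √(1 / t) = 1 / √t := by rw [Real.sqrt_div zero_le_one, Real.sqrt_one]
  rw [hs] at hsymm
  have ht2 : √t ^ 2 = t := Real.sq_sqrt ht.le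
  have hst : 0 < √t := Real.sqrt_pos.mpr ht
  have hsq : 0 < √(q : ℝ) := Real.sqrt_pos.mpr hq'
  set X := B / (2 * √q) + lambertSum c (2 * Real.pi * (1 / t) / √q)
  set Y := B / (2 * √q) + lambertSum c (2 * Real.pi * t / √q)
  have h3 : 2 * √q * √t * X = 2 * √q * √t * (W * t * Y) := by
    have : 2 * √q * √t * X = 2 * √q / (1 / √t) * X := by field_simp
    have e5 : t ^ 2 / √t = √t * t := by
      rw [div_eq_iff hst.ne']
      linear_combination (-t) * ht2
    rw [this, hsymm]
    linear_combination 2 * √q * W * Y * e5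
  exact mul_left_cancel₀ (by positivity) h3

end

section

open ArithmeticFunction

/-- The indicator function of perfect squares. -/
noncomputable def squareIndicator : ArithmeticFunction ℝ :=
  open scoped Classical in ⟨fun n => if n ≠ 0 ∧ IsSquare n then 1 else 0, by simp⟩

/-- The indicator function of squarefree numbers. -/
noncomputable def squarefreeIndicator : ArithmeticFunction ℝ :=
  ((moebius.pmul moebius : ArithmeticFunction ℤ) : ArithmeticFunction ℝ)

lemma squareIndicator_sq {n : ℕ} (hn : n ≠ 0) : squareIndicator (n ^ 2) = 1 := by
  simp [squareIndicator, hn, IsSquare.sq n]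

lemma squareIndicator_of_not_isSquare {n : ℕ} (hn : ¬ IsSquare n) : squareIndicator n = 0 := by
  simp [squareIndicator, hn]

lemma squareIndicator_nonneg (n : ℕ) : 0 ≤ squareIndicator n := by
  simp only [squareIndicator, coe_mk]
  split_ifs <;> simp

lemma isMultiplicative_squareIndicator : squareIndicator.IsMultiplicative := by
  rw [IsMultiplicative.iff_ne_zero]
  refine ⟨by simp [squareIndicator], fun {m n} hm hn hmn => ?_⟩
  have h : IsSquare (m * n) ↔ IsSquare m ∧ IsSquare n := by
    refine ⟨fun ⟨r, hr⟩ => ?_, fun ⟨h1, h2⟩ => h1.mul h2⟩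
    obtain ⟨a, ha⟩ := exists_eq_pow_of_mul_eq_pow (a := m) (b := n) (c := r) (k := 2)
      (Nat.isUnit_iff.mpr hmn) (by rw [hr, sq])
    obtain ⟨b, hb⟩ := exists_eq_pow_of_mul_eq_pow (a := n) (b := m) (c := r) (k := 2)
      (Nat.isUnit_iff.mpr hmn.symm) (by rw [mul_comm, hr, sq])
    exact ⟨⟨a, by rw [ha, sq]⟩, ⟨b, by rw [hb, sq]⟩⟩
  by_cases h1 : IsSquare m <;> by_cases h2 : IsSquare n <;> simp [squareIndicator, h, hm, hn, h1, h2]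

lemma isMultiplicative_squarefreeIndicator : squarefreeIndicator.IsMultiplicative :=
  (isMultiplicative_moebius.pmul isMultiplicative_moebius).intCast

lemma squarefreeIndicator_mul_apply_prime_pow (f : ArithmeticFunction ℝ) {p : ℕ} (hp : p.Prime)
    (k : ℕ) : (squarefreeIndicator * f) (p ^ (k + 1)) = f (p ^ (k + 1)) + f (p ^ k) := by
  rw [mul_apply, Nat.sum_divisorsAntidiagonal (fun i j => squarefreeIndicator i * f j),
    Nat.sum_divisors_prime_pow hp, Finset.sum_range_succ', Finset.sum_range_succ']
  have h (i : ℕ) : squarefreeIndicator (p ^ (i + 1 + 1)) = 0 := by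
    simp [squarefreeIndicator, moebius_apply_prime_pow hp]
  have h1 : squarefreeIndicator (p ^ 1) = 1 := by
    simp [squarefreeIndicator, moebius_apply_prime hp]
  have h0 : squarefreeIndicator (p ^ 0) = 1 := by
    simp [squarefreeIndicator]
  simp only [zero_add, h, h0, h1, zero_mul, Finset.sum_const_zero, one_mul]
  rw [pow_zero, Nat.div_one, pow_one, pow_succ, Nat.mul_div_cancel _ hp.pos, add_comm]

lemma squarefreeIndicator_mul_squareIndicator :
    squarefreeIndicator * squareIndicator = (zeta : ArithmeticFunction ℝ) := by
  refine (IsMultiplicative.eq_iff_eq_on_prime_powers _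
    (isMultiplicative_squarefreeIndicator.mul isMultiplicative_squareIndicator) _
    isMultiplicative_zeta.natCast).mpr fun p k hp => ?_
  rcases k with _ | k
  · simp [(isMultiplicative_squarefreeIndicator.mul isMultiplicative_squareIndicator).1]
  · rw [squarefreeIndicator_mul_apply_prime_pow _ hp]
    have e (k : ℕ) (h : Even k) : squareIndicator (p ^ k) = 1 := by
      obtain ⟨j, rfl⟩ := h
      rw [← mul_two, pow_mul]
      exact squareIndicator_sq (pow_ne_zero _ hp.ne_zero)
    have o (k : ℕ) (h : ¬ Even k) : squareIndicator (p ^ k) = 0 := by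
      refine squareIndicator_of_not_isSquare fun ⟨r, hr⟩ => h ?_
      obtain ⟨j, -, rfl⟩ := (Nat.dvd_prime_pow hp).mp (Dvd.intro r hr.symm)
      rw [← pow_add] at hr
      exact ⟨j, Nat.pow_right_injective hp.two_le hr⟩
    have hz : (zeta : ArithmeticFunction ℝ) (p ^ (k + 1)) = 1 := by
      simp [natCoe_apply, zeta_apply, hp.ne_zero]
    rw [hz]
    by_cases hk : Even k
    · rw [e k hk, o (k + 1) (by simpa [Nat.even_add_one] using hk), zero_add]
    · rw [o k hk, e (k + 1) (by simpa [Nat.even_add_one] using hk), add_zero]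

/-- A completely multiplicative function viewed as an arithmetic function. -/
def homArithmeticFunction (c : ℕ →*₀ ℝ) : ArithmeticFunction ℝ := ⟨c, map_zero c⟩

lemma isMultiplicative_homArithmeticFunction (c : ℕ →*₀ ℝ) :
    (homArithmeticFunction c).IsMultiplicative :=
  ⟨map_one c, fun _ => map_mul c _ _⟩

/-- The convolution of `c` with the indicator of squarefree numbers. -/
noncomputable def primitiveCoeff (c : ℕ →*₀ ℝ) : ArithmeticFunction ℝ :=
  squarefreeIndicator * homArithmeticFunction c

variable {c : ℕ →*₀ ℝ}

lemma squareIndicator_mul_primitiveCoeff :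
    squareIndicator * primitiveCoeff c =
      (zeta : ArithmeticFunction ℝ) * homArithmeticFunction c := by
  rw [primitiveCoeff, ← mul_assoc, mul_comm squareIndicator,
    squarefreeIndicator_mul_squareIndicator]

lemma primitiveCoeff_nonneg (hc : ∀ n, c n = 0 ∨ c n = 1 ∨ c n = -1) (n : ℕ) :
    0 ≤ primitiveCoeff c n := by
  rcases eq_or_ne n 0 with rfl | hn
  · simp
  have hm : (primitiveCoeff c).IsMultiplicative :=
    isMultiplicative_squarefreeIndicator.mul (isMultiplicative_homArithmeticFunction c)
  rw [hm.multiplicative_factorization _ hn]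
  refine Finset.prod_nonneg fun p hp => ?_
  have hp := Nat.prime_of_mem_primeFactors hp
  rcases n.factorization p with _ | k
  · simp [hm.1]
  · have h : primitiveCoeff c (p ^ (k + 1)) = c (p ^ (k + 1)) + c (p ^ k) :=
      squarefreeIndicator_mul_apply_prime_pow _ hp k
    simp only [h]
    rw [map_pow, map_pow, pow_succ]
    rcases hc p with h | h | h <;> rw [h]
    · simp
    · norm_num
    · linarith

lemma primitiveCoeff_one : primitiveCoeff c 1 = 1 :=
  (isMultiplicative_squarefreeIndicator.mul (isMultiplicative_homArithmeticFunction c)).1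

lemma hasSum_lambertSum (hc : ∀ n, |c n| ≤ 1) {κ : ℝ} (hκ : 0 < κ) :
    HasSum (fun n : ℕ+ => ((zeta : ArithmeticFunction ℝ) * homArithmeticFunction c) n *
      Real.exp (-κ * n)) (lambertSum c κ) := by
  refine hasSum_arithmeticFunction_mul (φ := fun n => Real.exp (-κ * n)) ?_
  have hs : Summable fun x : ℕ+ × ℕ+ => c x.2 * Real.exp (-κ * (x.1 * x.2)) := by
    refine Summable.of_norm_bounded (summable_exp_neg_mul_mul hκ) fun x => ?_
    rw [norm_mul, Real.norm_of_nonneg (Real.exp_pos _).le]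
    exact mul_le_of_le_one_left (Real.exp_pos _).le (hc _)
  refine hs.hasSum.congr_fun fun x => ?_
  simp [natCoe_apply, zeta_apply, homArithmeticFunction]

lemma zeta_mul_homArithmeticFunction_nonneg (hc : ∀ n, c n = 0 ∨ c n = 1 ∨ c n = -1) (n : ℕ) :
    0 ≤ ((zeta : ArithmeticFunction ℝ) * homArithmeticFunction c) n := by
  rw [← squareIndicator_mul_primitiveCoeff, mul_apply]
  exact Finset.sum_nonneg fun x _ => mul_nonneg (squareIndicator_nonneg _)
    (primitiveCoeff_nonneg hc _)

lemma abs_le_one_of_values (hc : ∀ n, c n = 0 ∨ c n = 1 ∨ c n = -1) (n : ℕ) : |c n| ≤ 1 := by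
  rcases hc n with h | h | h <;> simp [h]

lemma hasSum_lambertSum_primitiveCoeff (hc : ∀ n, c n = 0 ∨ c n = 1 ∨ c n = -1) {κ : ℝ}
    (hκ : 0 < κ) :
    HasSum (fun z : ℕ+ × ℕ+ => primitiveCoeff c z.2 * Real.exp (-κ * (z.1 ^ 2 * z.2)))
      (lambertSum c κ) := by
  have h1 := hasSum_lambertSum (abs_le_one_of_values hc) hκ
  rw [← squareIndicator_mul_primitiveCoeff] at h1
  let F : ℕ+ × ℕ+ → ℝ := fun x => squareIndicator x.1 * primitiveCoeff c x.2 *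
    Real.exp (-κ * ((x.1 * x.2 : ℕ) : ℝ))
  have hF (x) : 0 ≤ F x := mul_nonneg (mul_nonneg (squareIndicator_nonneg _)
    (primitiveCoeff_nonneg hc _)) (Real.exp_pos _).le
  have hs : Summable F := by
    rw [← sigmaAntidiagonalEquivProd.summable_iff]
    refine (summable_sigma_of_nonneg fun x => hF _).mpr
      ⟨fun n => (hasSum_fintype _).summable, h1.summable.congr fun n => ?_⟩
    rw [tsum_fintype, ArithmeticFunction.mul_apply, Finset.sum_mul, ← Finset.sum_coe_sort
      (n : ℕ).divisorsAntidiagonal (fun x => squareIndicator x.1 * primitiveCoeff c x.2 *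
        Real.exp (-κ * n))]
    refine Finset.sum_congr rfl fun x _ => ?_
    have hx : (x.1.1 * x.1.2 : ℕ) = n := (Nat.mem_divisorsAntidiagonal.mp x.2).1
    simp [F, sigmaAntidiagonalEquivProd, divisorsAntidiagonalFactors, ← hx]
  have h2 := hasSum_arithmeticFunction_mul (φ := fun n => Real.exp (-κ * n)) hs.hasSum
  have h3 : HasSum F (lambertSum c κ) := h1.unique h2 ▸ hs.hasSum
  have hinj : Function.Injective fun z : ℕ+ × ℕ+ => (z.1 ^ 2, z.2) := fun z w h => by
    simp only [Prod.mk.injEq] at h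
    refine Prod.ext (PNat.coe_injective ?_) h.2
    have := congrArg PNat.val h.1
    simpa using this
  refine ((hinj.hasSum_iff fun x hx => ?_).mpr h3).congr_fun fun z => ?_
  · simp only [F]
    rw [squareIndicator_of_not_isSquare, zero_mul, zero_mul]
    rintro ⟨r, hr⟩
    have hr0 : 0 < r := Nat.pos_of_ne_zero fun h => by simp [h] at hr
    exact hx ⟨(⟨r, hr0⟩, x.2),
      Prod.ext (PNat.coe_injective ((PNat.pow_coe _ 2).trans ((sq r).trans hr.symm))) rfl⟩
  · simp only [F, Function.comp_apply, PNat.pow_coe]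
    rw [squareIndicator_sq z.1.ne_zero, one_mul]
    push_cast
    rfl

end

section

lemma jacobiPsi_nonneg (x : ℝ) : 0 ≤ jacobiPsi x := tsum_nonneg fun _ => (Real.exp_pos _).le

lemma exp_le_jacobiPsi {x : ℝ} (hx : 0 < x) : Real.exp (-Real.pi * x) ≤ jacobiPsi x := by
  have := (summable_exp_neg_sq hx).le_tsum 1 fun _ _ => (Real.exp_pos _).le
  simpa [jacobiPsi] using this

lemma jacobiPsi_le {x : ℝ} (hx : 0 < x) : jacobiPsi x ≤ 1 / (Real.exp (Real.pi * x) - 1) := by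
  have hr : Real.exp (-(Real.pi * x)) < 1 := Real.exp_lt_one_iff.mpr (by
    have := mul_pos Real.pi_pos hx
    linarith)
  have h1 := (hasSum_geometric_of_lt_one (Real.exp_pos _).le hr).mul_left
    (Real.exp (-(Real.pi * x)))
  have h2 : HasSum (fun k : ℕ+ => Real.exp (-(Real.pi * x)) * Real.exp (-(Real.pi * x)) ^ (k - 1 : ℕ))
      (Real.exp (-(Real.pi * x)) * (1 - Real.exp (-(Real.pi * x)))⁻¹) :=
    (Equiv.pnatEquivNat.hasSum_iff (f := fun k : ℕ =>
      Real.exp (-(Real.pi * x)) * Real.exp (-(Real.pi * x)) ^ k)).mpr h1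
  have e : Real.exp (-(Real.pi * x)) * (1 - Real.exp (-(Real.pi * x)))⁻¹ =
      1 / (Real.exp (Real.pi * x) - 1) := by
    have h0 : Real.exp (Real.pi * x) - 1 ≠ 0 := by
      have : 1 < Real.exp (Real.pi * x) := Real.one_lt_exp_iff.mpr (by positivity)
      linarith
    have h0' : 1 - (Real.exp (Real.pi * x))⁻¹ ≠ 0 := by
      rw [← Real.exp_neg]; linarith
    rw [Real.exp_neg]
    field_simp
  rw [← e, ← h2.tsum_eq]
  refine (summable_exp_neg_sq hx).tsum_le_tsum (fun k => ?_) h2.summable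
  rw [← pow_succ', Nat.sub_add_cancel (show 1 ≤ (k : ℕ) from k.2), ← Real.exp_nat_mul]
  refine Real.exp_le_exp.mpr ?_
  have hk : (1 : ℝ) ≤ k := by exact_mod_cast k.2
  have := mul_pos Real.pi_pos hx
  nlinarith [mul_nonneg (mul_nonneg (sub_nonneg.mpr hk) (zero_le_one.trans hk)) this.le]

/-- A lower bound for `ψ(u) - 2 ψ(4 u)`, uniform in `u`. -/
lemma exp_le_jacobiPsi_sub {u : ℝ} (hu : 0 < u) :
    Real.exp (-(2 * Real.pi * u)) / 4 ≤ jacobiPsi u - 2 * jacobiPsi (4 * u) := by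
  rcases le_total (1 / 4) u with h | h
  · have h1 := exp_le_jacobiPsi hu
    have h2 := jacobiPsi_le (x := 4 * u) (by positivity)
    have hw : 2 ≤ Real.exp (Real.pi * u) := by
      have : Real.exp (Real.log 2) ≤ Real.exp (Real.pi * u) := by
        refine Real.exp_le_exp.mpr ?_
        have := Real.log_two_lt_d9
        have := Real.pi_gt_d2
        nlinarith
      rwa [Real.exp_log two_pos] at this
    have e4 : Real.exp (Real.pi * (4 * u)) = Real.exp (Real.pi * u) ^ 4 := by
      rw [← Real.exp_nat_mul]; push_cast; ring_nf
    have e2 : Real.exp (-(2 * Real.pi * u)) = (Real.exp (Real.pi * u) ^ 2)⁻¹ := by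
      rw [Real.exp_neg, ← Real.exp_nat_mul]; push_cast; ring_nf
    have e1 : Real.exp (-Real.pi * u) = (Real.exp (Real.pi * u))⁻¹ := by
      rw [neg_mul, Real.exp_neg]
    rw [e4] at h2
    rw [e1] at h1
    rw [e2]
    set w := Real.exp (Real.pi * u)
    have hw4 : 16 ≤ w ^ 4 := by
      calc (16 : ℝ) = 2 ^ 4 := by norm_num
        _ ≤ w ^ 4 := by gcongr
    have h3 : (w ^ 2)⁻¹ / 4 + 2 * (1 / (w ^ 4 - 1)) ≤ w⁻¹ := by
      have h0 : 0 < w ^ 4 - 1 := by linarith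
      have h5 : 1 / (w ^ 4 - 1) ≤ 3 / (8 * w) := by
        rw [div_le_div_iff₀ h0 (by positivity)]
        have : 2 ^ 3 ≤ w ^ 3 := by gcongr
        nlinarith
      have h6 : (w ^ 2)⁻¹ ≤ w⁻¹ := by
        refine inv_anti₀ (by positivity) ?_
        nlinarith
      have h7 : 3 / (8 * w) = 3 / 8 * w⁻¹ := by field_simp
      have : 0 < w⁻¹ := by positivity
      rw [h7] at h5
      linarith
    linarith
  · have h1 := jacobiPsi_functional_equation (x := 1 / u) (by positivity)
    have h2 := jacobiPsi_functional_equation (x := 1 / (4 * u)) (by positivity)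
    rw [one_div_one_div] at h1 h2
    set x := 1 / (4 * u) with hx
    have hx1 : 1 ≤ x := by
      rw [hx, le_div_iff₀ (by positivity)]; linarith
    have hu4 : 1 / u = 4 * x := by rw [hx]; field_simp
    have hs : (1 / u) ^ (1 / 2 : ℝ) = 2 * x ^ (1 / 2 : ℝ) := by
      rw [hu4, Real.mul_rpow (by norm_num) (by positivity), show (4 : ℝ) = 2 ^ (2 : ℝ) by norm_num,
        ← Real.rpow_mul (by norm_num)]
      norm_num
    rw [hs] at h1
    have hsx : x ^ (1 / 2 : ℝ) ≤ x := by
      calc x ^ (1 / 2 : ℝ) ≤ x ^ (1 : ℝ) := Real.rpow_le_rpow_of_exponent_le hx1 (by norm_num)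
        _ = x := Real.rpow_one x
    have hsx0 : 0 < x ^ (1 / 2 : ℝ) := by positivity
    have h3 := jacobiPsi_le (x := x) (by positivity)
    have h4 := jacobiPsi_nonneg (1 / u)
    have h5 : x * (1 / (Real.exp (Real.pi * x) - 1)) ≤ 1 / 8 := by
      have h6 := Real.quadratic_le_exp_of_nonneg (x := Real.pi * x) (by positivity)
      have h7 := Real.pi_gt_d2
      have h8 : 8 * x ≤ Real.exp (Real.pi * x) - 1 := by
        have h9 : 3.14 * x ≤ Real.pi * x := by gcongr
        have h10 : (3.14 * x) ^ 2 ≤ (Real.pi * x) ^ 2 := by gcongr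
        nlinarith
      rw [mul_one_div, div_le_div_iff₀ (by linarith) (by norm_num)]
      linarith
    have h6 : x ^ (1 / 2 : ℝ) * jacobiPsi x ≤ 1 / 8 :=
      (mul_le_mul hsx h3 (jacobiPsi_nonneg x) (by positivity)).trans h5
    have h7 : Real.exp (-(2 * Real.pi * u)) ≤ 1 := Real.exp_le_one_iff.mpr (by
      have := mul_pos Real.pi_pos hu
      linarith)
    nlinarith [mul_nonneg hsx0.le h4]

variable {c : ℕ →*₀ ℝ} {a W κ : ℝ}

lemma lambertSum_pos (hc : ∀ n, c n = 0 ∨ c n = 1 ∨ c n = -1) (hκ : 0 < κ) :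
    0 < lambertSum c κ := by
  have h := hasSum_lambertSum_primitiveCoeff hc hκ
  rw [← h.tsum_eq]
  refine h.summable.tsum_pos (fun z => ?_) (1, 1) ?_
  · exact mul_nonneg (primitiveCoeff_nonneg hc _) (Real.exp_pos _).le
  · simp only [PNat.one_coe, primitiveCoeff_one, one_mul]
    exact Real.exp_pos _

lemma lambertSum_le_mul_exp (hc : ∀ n, c n = 0 ∨ c n = 1 ∨ c n = -1) (hκ : 0 < κ) {t : ℝ}
    (ht : 1 ≤ t) : lambertSum c (κ * t) ≤ lambertSum c κ * Real.exp (-(κ * (t - 1))) := by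
  have h1 := hasSum_lambertSum (abs_le_one_of_values hc) hκ
  have h2 := hasSum_lambertSum (abs_le_one_of_values hc) (mul_pos hκ (zero_lt_one.trans_le ht))
  refine hasSum_le (fun n => ?_) h2 (h1.mul_right _)
  rw [mul_assoc, ← Real.exp_add]
  refine mul_le_mul_of_nonneg_left (Real.exp_le_exp.mpr ?_)
    (zeta_mul_homArithmeticFunction_nonneg hc _)
  have hn : (1 : ℝ) ≤ n := by exact_mod_cast n.2
  nlinarith [mul_nonneg (mul_nonneg hκ.le (sub_nonneg.mpr ht)) (sub_nonneg.mpr hn)]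

/-- The sum `∑ r(n) exp(-κ n)` over `n`, with `r` the primitive coefficients. -/
noncomputable def primitiveSum (c : ℕ →*₀ ℝ) (κ : ℝ) : ℝ :=
  ∑' n : ℕ+, primitiveCoeff c n * Real.exp (-κ * n)

lemma hasSum_primitiveSum (hc : ∀ n, c n = 0 ∨ c n = 1 ∨ c n = -1) (hκ : 0 < κ) :
    HasSum (fun n : ℕ+ => primitiveCoeff c n * Real.exp (-κ * n)) (primitiveSum c κ) := by
  have h := (hasSum_lambertSum_primitiveCoeff hc hκ).summable.comp_injective
    (i := fun n : ℕ+ => ((1 : ℕ+), n)) fun _ _ h => (Prod.mk.injEq _ _ _ _ ▸ h).2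
  refine Summable.hasSum (h.congr fun n => ?_)
  simp

lemma primitiveSum_pos (hc : ∀ n, c n = 0 ∨ c n = 1 ∨ c n = -1) (hκ : 0 < κ) :
    0 < primitiveSum c κ := by
  refine (hasSum_primitiveSum hc hκ).summable.tsum_pos (fun z => ?_) 1 ?_
  · exact mul_nonneg (primitiveCoeff_nonneg hc _) (Real.exp_pos _).le
  · simp only [PNat.one_coe, primitiveCoeff_one, one_mul]
    exact Real.exp_pos _

lemma hasSum_lambertSum_jacobiPsi (hc : ∀ n, c n = 0 ∨ c n = 1 ∨ c n = -1) (hκ : 0 < κ) :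
    HasSum (fun n : ℕ+ => primitiveCoeff c n * jacobiPsi (κ * n / Real.pi)) (lambertSum c κ) := by
  have h := (Equiv.prodComm ℕ+ ℕ+).hasSum_iff.mpr (hasSum_lambertSum_primitiveCoeff hc hκ)
  refine h.prod_fiberwise fun n => ?_
  have h1 : HasSum (fun k : ℕ+ => Real.exp (-Real.pi * k ^ 2 * (κ * n / Real.pi)))
      (jacobiPsi (κ * n / Real.pi)) :=
    (summable_exp_neg_sq (by have := Real.pi_pos; positivity)).hasSum
  refine (h1.mul_left (primitiveCoeff c n)).congr_fun fun k => ?_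
  have : -Real.pi * (k : ℝ) ^ 2 * (κ * n / Real.pi) = -κ * (k ^ 2 * n) := by
    field_simp
  rw [this]
  rfl

lemma primitiveSum_le_lambertSum_sub (hc : ∀ n, c n = 0 ∨ c n = 1 ∨ c n = -1) (hκ : 0 < κ) :
    primitiveSum c κ / 4 ≤ lambertSum c (κ * (1 / 2)) - 2 * lambertSum c (κ * 2) := by
  have h1 := hasSum_lambertSum_jacobiPsi hc (κ := κ * (1 / 2)) (by positivity)
  have h2 := hasSum_lambertSum_jacobiPsi hc (κ := κ * 2) (by positivity)
  refine hasSum_le (fun n => ?_) ((hasSum_primitiveSum hc hκ).div_const 4)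
    (h1.sub (h2.mul_left 2))
  have hu : 0 < κ * (1 / 2) * n / Real.pi := by have := Real.pi_pos; positivity
  have h := mul_le_mul_of_nonneg_left (exp_le_jacobiPsi_sub hu) (primitiveCoeff_nonneg hc n)
  have e1 : -(2 * Real.pi * (κ * (1 / 2) * n / Real.pi)) = -κ * n := by field_simp
  have e2 : 4 * (κ * (1 / 2) * n / Real.pi) = κ * 2 * n / Real.pi := by ring
  rw [e1, e2] at h
  linarith

lemma lambertSum_le_primitiveSum_mul (hc : ∀ n, c n = 0 ∨ c n = 1 ∨ c n = -1) (hκ : 0 < κ) {t : ℝ}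
    (ht : 1 ≤ t) :
    lambertSum c (κ * t) ≤
      primitiveSum c κ * ∑' k : ℕ+, Real.exp (-(κ * (k ^ 2 * t - 1))) := by
  have ht0 : 0 < t := zero_lt_one.trans_le ht
  have h1 := hasSum_lambertSum_primitiveCoeff hc (mul_pos hκ ht0)
  have h2 := hasSum_primitiveSum hc hκ
  have h3 : Summable fun k : ℕ+ => Real.exp (-(κ * (k ^ 2 * t - 1))) := by
    have := (summable_exp_neg_sq (x := κ * t / Real.pi)
      (by have := Real.pi_pos; positivity)).mul_left (Real.exp κ)
    refine this.congr fun k => ?_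
    rw [← Real.exp_add]
    congr 1
    field_simp
    ring
  have h4 : Summable fun z : ℕ+ × ℕ+ => Real.exp (-(κ * ((z.1 : ℝ) ^ 2 * t - 1))) *
      (primitiveCoeff c z.2 * Real.exp (-κ * z.2)) :=
    h3.mul_of_nonneg h2.summable (fun _ => (Real.exp_pos _).le) fun n =>
      mul_nonneg (primitiveCoeff_nonneg hc _) (Real.exp_pos _).le
  rw [mul_comm (primitiveSum c κ), ← h2.tsum_eq, h3.tsum_mul_tsum h2.summable h4, ← h1.tsum_eq]
  refine h1.summable.tsum_le_tsum (fun z => ?_) h4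
  rw [mul_left_comm (Real.exp _), ← Real.exp_add]
  refine mul_le_mul_of_nonneg_left (Real.exp_le_exp.mpr ?_) (primitiveCoeff_nonneg hc _)
  have hn : (1 : ℝ) ≤ z.2 := by exact_mod_cast z.2.2
  have hk : (1 : ℝ) ≤ z.1 := by exact_mod_cast z.1.2
  have hkt : 0 ≤ (z.1 : ℝ) ^ 2 * t - 1 := by nlinarith
  nlinarith [mul_nonneg (mul_nonneg hκ.le hkt) (sub_nonneg.mpr hn)]

lemma sign_eq_of_functional_equation (hc : ∀ n, c n = 0 ∨ c n = 1 ∨ c n = -1) (hκ : 0 < κ)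
    (hFE : ∀ t : ℝ, 0 < t → a + lambertSum c (κ * (1 / t)) = W * t * (a + lambertSum c (κ * t))) :
    W = 1 ∨ W = -1 := by
  rw [← sq_eq_one_iff]
  by_contra hW
  have h (t : ℝ) (ht : 0 < t) : a + lambertSum c (κ * t) = 0 := by
    have h1 := hFE t ht
    have h2 := hFE (1 / t) (by positivity)
    rw [one_div_one_div, h1] at h2
    have h3 : (1 - W ^ 2) * (a + lambertSum c (κ * t)) = 0 := by
      have : t * t⁻¹ = 1 := mul_inv_cancel₀ ht.ne'
      rw [one_div] at h2
      linear_combination h2 + W ^ 2 * (a + lambertSum c (κ * t)) * this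
    exact (mul_eq_zero.mp h3).resolve_left fun h => hW (by linarith)
  have h1 := h 1 one_pos
  have h2 := h 2 two_pos
  have h3 := lambertSum_le_mul_exp hc hκ one_le_two
  have h4 := lambertSum_pos hc hκ
  have h5 : Real.exp (-(κ * (2 - 1))) < 1 := Real.exp_lt_one_iff.mpr (by linarith)
  rw [mul_one] at h1
  nlinarith

end

section

open MeasureTheory Set

lemma integral_rpow_mul_lambertSum {c : ℕ → ℝ} (hc : ∀ n, |c n| ≤ 1) {κ s : ℝ} (hκ : 0 < κ)
    (hs : 1 < s) :
    IntegrableOn (fun t => t ^ (s - 1) * lambertSum c (κ * t)) (Ioi 0) ∧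
    ∫ t in Ioi 0, t ^ (s - 1) * lambertSum c (κ * t) =
      Real.Gamma s * κ ^ (-s) *
        ((∑' n : ℕ+, (n : ℝ) ^ (-s)) * ∑' n : ℕ, c n * (n : ℝ) ^ (-s)) := by
  have hΓ : 0 < Real.Gamma s := Real.Gamma_pos_of_pos (by linarith)
  let E : ℕ+ × ℕ+ → ℝ → ℝ := fun z t => t ^ (s - 1) * Real.exp (-(κ * (z.1 * z.2) * t))
  have hEi (z) : ∫ t in Ioi 0, E z t =
      Real.Gamma s * κ ^ (-s) * ((z.1 : ℝ) ^ (-s) * (z.2 : ℝ) ^ (-s)) := by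
    simp only [E]
    rw [Real.integral_rpow_mul_exp_neg_mul_Ioi (by linarith) (by positivity), one_div,
      Real.inv_rpow (by positivity), ← Real.rpow_neg (by positivity),
      Real.mul_rpow hκ.le (by positivity), Real.mul_rpow (by positivity) (by positivity)]
    ring
  have hE (z) : IntegrableOn (E z) (Ioi 0) := by
    refine Integrable.of_integral_ne_zero ?_
    rw [hEi]
    positivity
  have hsum := summable_pnat_rpow_neg hs
  have hsum2 : Summable fun n : ℕ+ => c n * (n : ℝ) ^ (-s) := by
    refine Summable.of_norm_bounded hsum fun n => ?_
    rw [norm_mul, Real.norm_of_nonneg (show (0 : ℝ) ≤ (n : ℝ) ^ (-s) by positivity)]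
    exact mul_le_of_le_one_left (by positivity) (hc n)
  have hprod : Summable fun z : ℕ+ × ℕ+ => (z.1 : ℝ) ^ (-s) * (z.2 : ℝ) ^ (-s) :=
    hsum.mul_of_nonneg hsum (fun _ => by positivity) fun _ => by positivity
  let F : ℕ+ × ℕ+ → ℝ → ℝ := fun z t => c z.2 * E z t
  have hF (z) : IntegrableOn (F z) (Ioi 0) := (hE z).const_mul _
  have hFs : Summable fun z => ∫ t in Ioi 0, ‖F z t‖ := by
    refine Summable.of_nonneg_of_le (fun z => integral_nonneg fun _ => norm_nonneg _) (fun z => ?_)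
      (hprod.mul_left (Real.Gamma s * κ ^ (-s)))
    rw [← hEi]
    refine setIntegral_mono_on (hF z).norm (hE z) measurableSet_Ioi fun t ht => ?_
    have ht : 0 < t := ht
    have h0 : 0 ≤ E z t := by positivity
    rw [norm_mul, Real.norm_of_nonneg h0]
    exact mul_le_of_le_one_left h0 (hc _)
  have hpt (t : ℝ) (ht : 0 < t) :
      HasSum (fun z => F z t) (t ^ (s - 1) * lambertSum c (κ * t)) := by
    have h1 : Summable fun x : ℕ+ × ℕ+ => c x.2 * Real.exp (-(κ * t) * (x.1 * x.2)) := by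
      refine Summable.of_norm_bounded (summable_exp_neg_mul_mul (mul_pos hκ ht)) fun x => ?_
      rw [norm_mul, Real.norm_of_nonneg (Real.exp_pos _).le]
      exact mul_le_of_le_one_left (Real.exp_pos _).le (hc _)
    refine (h1.hasSum.mul_left (t ^ (s - 1))).congr_fun fun z => ?_
    simp only [F, E]
    have : -(κ * (z.1 * z.2) * t) = -(κ * t) * (z.1 * z.2) := by ring
    rw [this]
    ring
  constructor
  · refine IntegrableOn.congr_fun (integrable_tsum_of_summable_integral_norm hF hFs ?_)
      (fun t ht => (hpt t ht).tsum_eq) measurableSet_Ioi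
    exact (ae_restrict_mem measurableSet_Ioi).mono fun t ht => (hpt t ht).summable
  · have h := hasSum_integral_of_summable_integral_norm hF hFs
    rw [setIntegral_congr_fun measurableSet_Ioi fun t ht => (hpt t ht).tsum_eq] at h
    have h2 : HasSum (fun n : ℕ+ => c n * (n : ℝ) ^ (-s)) (∑' n : ℕ, c n * (n : ℝ) ^ (-s)) := by
      refine hasSum_pnat_of_hasSum_nat (f := fun n : ℕ => c n * (n : ℝ) ^ (-s)) ?_ ?_
      · simp [Real.zero_rpow (show -s ≠ 0 by linarith)]
      · refine (Summable.of_norm_bounded (Real.summable_nat_rpow (p := -s) |>.mpr (by linarith))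
          fun n => ?_).hasSum
        rw [norm_mul, Real.norm_of_nonneg (show (0 : ℝ) ≤ (n : ℝ) ^ (-s) by positivity)]
        exact mul_le_of_le_one_left (by positivity) (hc n)
    have h4 : Summable fun z : ℕ+ × ℕ+ => (z.1 : ℝ) ^ (-s) * (c z.2 * (z.2 : ℝ) ^ (-s)) :=
      summable_mul_of_summable_norm (f := fun n : ℕ+ => (n : ℝ) ^ (-s))
        (g := fun n : ℕ+ => c n * (n : ℝ) ^ (-s)) hsum.norm hsum2.norm
    have h3 : HasSum (fun z : ℕ+ × ℕ+ => (z.1 : ℝ) ^ (-s) * (c z.2 * (z.2 : ℝ) ^ (-s))) _ :=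
      HasSum.mul (f := fun n : ℕ+ => (n : ℝ) ^ (-s))
        (g := fun n : ℕ+ => c n * (n : ℝ) ^ (-s)) hsum.hasSum h2 h4
    refine h.unique ((h3.mul_left (Real.Gamma s * κ ^ (-s))).congr_fun fun z => ?_)
    simp only [F]
    rw [integral_const_mul, hEi]
    ring

lemma integral_Ioi_zero_eq_add {g : ℝ → ℝ} (hg : IntegrableOn g (Ioi 0)) :
    IntegrableOn (fun x => x ^ (-2 : ℝ) * g (1 / x)) (Ioi 1) ∧
    ∫ x in Ioi 0, g x = (∫ x in Ioi 1, g x) + ∫ x in Ioi 1, x ^ (-2 : ℝ) * g (1 / x) := by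
  let f := (Iio (1 : ℝ)).indicator g
  have key : ∀ x ∈ Ioi (0 : ℝ), (|(-1 : ℝ)| * x ^ (-1 - 1 : ℝ)) • f (x ^ (-1 : ℝ)) =
      (Ioi (1 : ℝ)).indicator (fun x => x ^ (-2 : ℝ) * g (1 / x)) x := fun x hx => by
    have hx : 0 < x := hx
    simp only [f, Real.rpow_neg_one, smul_eq_mul, abs_neg, abs_one, one_mul]
    rw [show (-1 - 1 : ℝ) = -2 by norm_num]
    by_cases h : 1 < x
    · rw [indicator_of_mem (mem_Iio.mpr (inv_lt_one_of_one_lt₀ h)), indicator_of_mem (mem_Ioi.mpr h),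
        one_div]
    · rw [indicator_of_notMem, indicator_of_notMem (by simpa using h), mul_zero]
      simpa using one_le_inv₀ hx |>.mpr (not_lt.mp h)
  have hf : IntegrableOn f (Ioi 0) := hg.indicator measurableSet_Iio
  have hsub : Ioi (1 : ℝ) ∩ Ioi 0 = Ioi 1 := by
    rw [Ioi_inter_Ioi]; norm_num
  constructor
  · have h1 := IntegrableOn.congr_fun
      ((integrableOn_Ioi_comp_rpow_iff f (p := -1) (by norm_num)).mpr hf) key measurableSet_Ioi
    rw [IntegrableOn, integrable_indicator_iff measurableSet_Ioi, IntegrableOn,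
      Measure.restrict_restrict measurableSet_Ioi, hsub] at h1
    exact h1
  · have h1 := integral_comp_rpow_Ioi f (p := -1) (by norm_num)
    rw [setIntegral_congr_fun measurableSet_Ioi key, integral_indicator measurableSet_Ioi,
      Measure.restrict_restrict measurableSet_Ioi, hsub] at h1
    have hIci : ∫ x in Ioi 1, g x = ∫ x in Ici 1, g x := integral_Ici_eq_integral_Ioi.symm
    rw [h1, integral_indicator measurableSet_Iio, Measure.restrict_restrict measurableSet_Iio,
      hIci, add_comm,
      ← setIntegral_union (by
        rw [disjoint_left]
        rintro x ⟨h, -⟩ h'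
        exact absurd (mem_Iio.mp h) (not_lt.mpr (mem_Ici.mp h'))) measurableSet_Ici
        (hg.mono_set inter_subset_right)
        (hg.mono_set fun x hx => zero_lt_one.trans_le hx)]
    congr 2
    ext x
    simp only [mem_Ioi, mem_union, mem_inter_iff, mem_Iio, mem_Ici]
    constructor
    · intro h
      rcases lt_or_ge x 1 with h1 | h1
      · exact Or.inl ⟨h1, h⟩
      · exact Or.inr h1
    · rintro (h | h)
      · exact h.2
      · linarith

/-- The Mellin transform of the Lambert series, after splitting at `1` and applying the functional
equation. -/
lemma integral_lambertSum_eq {c : ℕ → ℝ} (hc : ∀ n, |c n| ≤ 1) {κ a W δ : ℝ} (hκ : 0 < κ)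
    (hδ : 0 < δ)
    (hFE : ∀ t : ℝ, 0 < t → a + lambertSum c (κ * (1 / t)) = W * t * (a + lambertSum c (κ * t))) :
    IntegrableOn (fun t => t ^ δ * lambertSum c (κ * t)) (Ioi 1) ∧
    IntegrableOn (fun t => t ^ (-(1 + δ)) * lambertSum c (κ * t)) (Ioi 1) ∧
    ∫ t in Ioi 0, t ^ δ * lambertSum c (κ * t) =
      (∫ t in Ioi 1, t ^ δ * lambertSum c (κ * t)) +
      W * (∫ t in Ioi 1, t ^ (-(1 + δ)) * lambertSum c (κ * t)) + W * a / δ - a / (1 + δ) := by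
  have h0 := (integral_rpow_mul_lambertSum hc hκ (s := 1 + δ) (by linarith)).1
  rw [add_sub_cancel_left] at h0
  have h1 : IntegrableOn (fun t => t ^ δ * lambertSum c (κ * t)) (Ioi 1) :=
    h0.mono_set (Ioi_subset_Ioi zero_le_one)
  have h2 : IntegrableOn (fun t => t ^ (-(1 + δ)) * lambertSum c (κ * t)) (Ioi 1) := by
    have h3 : IntegrableOn (fun t : ℝ => t ^ (-(1 + 2 * δ)) * (t ^ δ * lambertSum c (κ * t)))
        (Ioi 1) := by
      refine Integrable.mono h1 ((Measurable.aestronglyMeasurable (by fun_prop)).mul h1.1)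
        ((ae_restrict_mem measurableSet_Ioi).mono fun x hx => ?_)
      have hx : (1 : ℝ) < x := hx
      rw [norm_mul, Real.norm_of_nonneg (by positivity)]
      exact mul_le_of_le_one_left (norm_nonneg _)
        (Real.rpow_le_one_of_one_le_of_nonpos hx.le (by linarith))
    refine IntegrableOn.congr_fun h3 (fun x hx => ?_) measurableSet_Ioi
    have hx : 0 < x := zero_lt_one.trans hx
    rw [← mul_assoc, ← Real.rpow_add hx]
    ring_nf
  refine ⟨h1, h2, ?_⟩
  have hp1 : IntegrableOn (fun t : ℝ => t ^ (-(1 + δ))) (Ioi 1) :=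
    integrableOn_Ioi_rpow_of_lt (by linarith) one_pos
  have hp2 : IntegrableOn (fun t : ℝ => t ^ (-(2 + δ))) (Ioi 1) :=
    integrableOn_Ioi_rpow_of_lt (by linarith) one_pos
  rw [(integral_Ioi_zero_eq_add h0).2]
  have e : ∀ x ∈ Ioi (1 : ℝ), x ^ (-2 : ℝ) * ((1 / x) ^ δ * lambertSum c (κ * (1 / x))) =
      W * (x ^ (-(1 + δ)) * lambertSum c (κ * x)) + W * a * x ^ (-(1 + δ)) -
        a * x ^ (-(2 + δ)) := fun x hx => by
    have hx : 0 < x := zero_lt_one.trans hx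
    have e1 : lambertSum c (κ * (1 / x)) = W * x * (a + lambertSum c (κ * x)) - a := by
      linarith [hFE x hx]
    have e2 : x ^ (-2 : ℝ) * (1 / x) ^ δ = x ^ (-(2 + δ)) := by
      rw [one_div, Real.inv_rpow hx.le, ← Real.rpow_neg hx.le, ← Real.rpow_add hx]
      ring_nf
    have e3 : x ^ (-(1 + δ)) = x ^ (-(2 + δ)) * x := by
      rw [← Real.rpow_add_one hx.ne']
      ring_nf
    rw [← mul_assoc, e2, e1, e3]
    ring
  rw [setIntegral_congr_fun measurableSet_Ioi e, integral_sub _ (hp2.const_mul a),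
    integral_add (h2.const_mul W) (hp1.const_mul _), integral_const_mul, integral_const_mul,
    integral_const_mul, integral_Ioi_rpow_of_lt (by linarith) one_pos,
    integral_Ioi_rpow_of_lt (by linarith) one_pos, Real.one_rpow, Real.one_rpow]
  · have e1 : -(1 + δ) + 1 = -δ := by ring
    have e2 : -(2 + δ) + 1 = -(1 + δ) := by ring
    rw [e1, e2, neg_div_neg_eq, neg_div_neg_eq]
    ring
  · exact (h2.const_mul W).add (hp1.const_mul _)

end

section

open MeasureTheory Set

variable {c : ℕ →*₀ ℝ} {a W κ δ : ℝ}

lemma rpow_le_exp_mul_sub_one {t : ℝ} (hδ : 0 < δ) (ht : 0 < t) :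
    t ^ δ ≤ Real.exp (δ * (t - 1)) := by
  rw [Real.rpow_def_of_pos ht, Real.exp_le_exp, mul_comm]
  exact mul_le_mul_of_nonneg_left (Real.log_le_sub_one_of_pos ht) hδ.le

lemma integral_rpow_mul_lambertSum_le_lambertSum (hc : ∀ n, c n = 0 ∨ c n = 1 ∨ c n = -1)
    (hκ : 0 < κ) (hδ : 0 < δ) (hδκ : δ ≤ κ / 2)
    (hint : IntegrableOn (fun t => t ^ δ * lambertSum c (κ * t)) (Ioi 1)) :
    ∫ t in Ioi 1, t ^ δ * lambertSum c (κ * t) ≤ 2 / κ * lambertSum c κ := by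
  have hneg : δ - κ < 0 := by linarith
  have hE := integrableOn_exp_mul_Ioi hneg 1
  have hpos := lambertSum_pos hc hκ
  calc ∫ t in Ioi 1, t ^ δ * lambertSum c (κ * t)
      ≤ ∫ t in Ioi 1, lambertSum c κ * Real.exp (κ - δ) * Real.exp ((δ - κ) * t) := by
        refine setIntegral_mono_on hint (hE.const_mul _) measurableSet_Ioi fun t ht => ?_
        have ht : (1 : ℝ) < t := ht
        calc t ^ δ * lambertSum c (κ * t)
            ≤ Real.exp (δ * (t - 1)) * (lambertSum c κ * Real.exp (-(κ * (t - 1)))) :=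
              mul_le_mul (rpow_le_exp_mul_sub_one hδ (by linarith))
                (lambertSum_le_mul_exp hc hκ ht.le)
                (lambertSum_pos hc (by positivity)).le (Real.exp_pos _).le
          _ = lambertSum c κ * Real.exp (κ - δ) * Real.exp ((δ - κ) * t) := by
              rw [mul_left_comm, mul_assoc, ← Real.exp_add, ← Real.exp_add]
              ring_nf
    _ = lambertSum c κ * (1 / (κ - δ)) := by
        rw [integral_const_mul, integral_exp_mul_Ioi hneg, mul_assoc, ← neg_sub κ δ,
          neg_div_neg_eq, ← mul_div_assoc, ← Real.exp_add]
        simp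
    _ ≤ lambertSum c κ * (2 / κ) := by
        refine mul_le_mul_of_nonneg_left ?_ hpos.le
        rw [div_le_div_iff₀ (by linarith) hκ]
        linarith
    _ = 2 / κ * lambertSum c κ := mul_comm _ _

lemma integral_rpow_mul_lambertSum_le_primitiveSum (hc : ∀ n, c n = 0 ∨ c n = 1 ∨ c n = -1)
    (hκ : 0 < κ) (hδ : 0 < δ) (hδκ : δ ≤ κ / 2)
    (hint : IntegrableOn (fun t => t ^ δ * lambertSum c (κ * t)) (Ioi 1)) :
    ∫ t in Ioi 1, t ^ δ * lambertSum c (κ * t) ≤ 4 / κ * primitiveSum c κ := by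
  let F : ℕ+ → ℝ → ℝ := fun k t =>
    primitiveSum c κ * Real.exp (κ - δ) * Real.exp ((δ - κ * k ^ 2) * t)
  have hV := primitiveSum_pos hc hκ
  have hk (k : ℕ+) : (1 : ℝ) ≤ k ^ 2 := one_le_pow₀ (by exact_mod_cast k.2)
  have hneg (k : ℕ+) : δ - κ * k ^ 2 < 0 := by nlinarith [hk k]
  have hF (k) : IntegrableOn (F k) (Ioi 1) := (integrableOn_exp_mul_Ioi (hneg k) 1).const_mul _
  have hF0 (k t) : 0 ≤ F k t := by positivity
  have hFi (k) : ∫ t in Ioi 1, F k t ≤ primitiveSum c κ * (2 / κ) * (k : ℝ) ^ (-(1 + 1) : ℝ) := by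
    simp only [F]
    rw [integral_const_mul, integral_exp_mul_Ioi (hneg k), mul_assoc, mul_assoc]
    refine mul_le_mul_of_nonneg_left ?_ hV.le
    rw [← neg_sub (κ * (k : ℝ) ^ 2) δ, neg_div_neg_eq, ← mul_div_assoc, ← Real.exp_add,
      show (-(1 + 1) : ℝ) = -(2 : ℕ) by norm_num, Real.rpow_neg (by positivity),
      Real.rpow_natCast, ← div_eq_mul_inv, div_div,
      div_le_div_iff₀ (by linarith [hneg k]) (by positivity)]
    have h1 : Real.exp (κ - δ + -(κ * (k : ℝ) ^ 2 - δ) * 1) ≤ 1 :=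
      Real.exp_le_one_iff.mpr (by nlinarith [hk k])
    have h2 : 0 ≤ κ * (k : ℝ) ^ 2 := by positivity
    nlinarith [hk k]
  have hs := (summable_pnat_rpow_neg (s := 1 + 1) (by norm_num)).mul_left
    (primitiveSum c κ * (2 / κ))
  have hFs : Summable fun k => ∫ t in Ioi 1, ‖F k t‖ := by
    refine Summable.of_nonneg_of_le (fun k => integral_nonneg fun _ => norm_nonneg _) (fun k => ?_)
      hs
    simp only [Real.norm_of_nonneg (hF0 _ _)]
    exact hFi k
  have hsum (t : ℝ) (ht : 1 < t) : Summable fun k => F k t := by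
    refine Summable.mul_left _ ?_
    refine Summable.of_nonneg_of_le (fun _ => (Real.exp_pos _).le) (fun k => ?_)
      (summable_pnat_rpow_neg (s := 1 + 1) (by norm_num) |>.mul_left (2 / κ))
    have h1 : 0 < κ * k ^ 2 * t - δ * t := by nlinarith [hneg k]
    have h2 : 1 / (κ * k ^ 2 / 2) = 2 / κ * (k : ℝ) ^ (-(1 + 1) : ℝ) := by
      rw [show (-(1 + 1) : ℝ) = -(2 : ℕ) by norm_num, Real.rpow_neg (by positivity),
        Real.rpow_natCast]
      field_simp
    rw [← h2, show (δ - κ * k ^ 2) * t = -((κ * k ^ 2 - δ) * t) by ring, Real.exp_neg, ← one_div]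
    refine one_div_le_one_div_of_le (by positivity) ?_
    have h3 := Real.add_one_le_exp ((κ * (k : ℝ) ^ 2 - δ) * t)
    nlinarith [hk k, hneg k]
  have hI := integrable_tsum_of_summable_integral_norm hF hFs
    ((ae_restrict_mem measurableSet_Ioi).mono fun t ht => hsum t ht)
  have hS := hasSum_integral_of_summable_integral_norm hF hFs
  have h1 : ∫ t in Ioi 1, t ^ δ * lambertSum c (κ * t) ≤ ∫ t in Ioi 1, ∑' k, F k t := by
    refine setIntegral_mono_on hint hI measurableSet_Ioi fun t ht => ?_
    have ht : (1 : ℝ) < t := ht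
    calc t ^ δ * lambertSum c (κ * t)
        ≤ Real.exp (δ * (t - 1)) *
          (primitiveSum c κ * ∑' k : ℕ+, Real.exp (-(κ * (k ^ 2 * t - 1)))) :=
          mul_le_mul (rpow_le_exp_mul_sub_one hδ (by linarith))
            (lambertSum_le_primitiveSum_mul hc hκ ht.le)
            (lambertSum_pos hc (by positivity)).le (Real.exp_pos _).le
      _ = ∑' k, F k t := by
          rw [mul_left_comm, ← mul_assoc, ← tsum_mul_left]
          refine tsum_congr fun k => ?_
          simp only [F]
          rw [mul_assoc, mul_assoc, ← Real.exp_add, ← Real.exp_add]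
          ring_nf
  calc _ ≤ ∫ t in Ioi 1, ∑' k, F k t := h1
    _ = ∑' k, ∫ t in Ioi 1, F k t := hS.tsum_eq.symm
    _ ≤ ∑' k : ℕ+, primitiveSum c κ * (2 / κ) * (k : ℝ) ^ (-(1 + 1) : ℝ) :=
        hS.summable.tsum_le_tsum hFi hs
    _ ≤ primitiveSum c κ * (2 / κ) * (1 + 1 / 1) := by
        rw [tsum_mul_left]
        exact mul_le_mul_of_nonneg_left (tsum_rpow_neg_le one_pos) (by positivity)
    _ = 4 / κ * primitiveSum c κ := by ring

/-- Near `s = 1` the completed zeta function of the quadratic order has size `A / (s - 1)`. -/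
lemma exists_integral_lambertSum_bounds (hc : ∀ n, c n = 0 ∨ c n = 1 ∨ c n = -1) (hκ : 0 < κ)
    (hFE : ∀ t : ℝ, 0 < t → a + lambertSum c (κ * (1 / t)) = W * t * (a + lambertSum c (κ * t))) :
    ∃ A : ℝ, 0 < A ∧ ∀ δ : ℝ, 0 < δ → δ ≤ 1 → δ ≤ κ / 2 →
      A / (2 * δ) ≤ ∫ t in Ioi 0, t ^ δ * lambertSum c (κ * t) ∧
      ∫ t in Ioi 0, t ^ δ * lambertSum c (κ * t) ≤ 17 * A / δ := by
  have hmono (δ : ℝ) (hδ : 0 < δ) :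
      0 ≤ ∫ t in Ioi 1, t ^ (-(1 + δ)) * lambertSum c (κ * t) ∧
      ∫ t in Ioi 1, t ^ (-(1 + δ)) * lambertSum c (κ * t) ≤
        ∫ t in Ioi 1, t ^ δ * lambertSum c (κ * t) := by
    obtain ⟨h1, h2, -⟩ := integral_lambertSum_eq (abs_le_one_of_values hc) hκ hδ hFE
    refine ⟨setIntegral_nonneg measurableSet_Ioi fun t ht => ?_,
      setIntegral_mono_on h2 h1 measurableSet_Ioi fun t ht => ?_⟩
    all_goals
      have ht : (1 : ℝ) < t := ht
      have hT := (lambertSum_pos hc (κ := κ * t) (by positivity)).le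
    · positivity
    · exact mul_le_mul_of_nonneg_right (Real.rpow_le_rpow_of_exponent_le ht.le (by linarith)) hT
  rcases sign_eq_of_functional_equation hc hκ hFE with rfl | rfl
  · have ha : primitiveSum c κ / 4 ≤ a := by
      have h1 := hFE 2 two_pos
      linarith [primitiveSum_le_lambertSum_sub hc hκ]
    have hV := primitiveSum_pos hc hκ
    refine ⟨a, by linarith, fun δ hδ hδ1 hδκ => ?_⟩
    obtain ⟨h1, h2, h3⟩ := integral_lambertSum_eq (abs_le_one_of_values hc) hκ hδ hFE
    obtain ⟨h4, h5⟩ := hmono δ hδ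
    have h6 := integral_rpow_mul_lambertSum_le_primitiveSum hc hκ hδ hδκ h1
    have h7 : 4 / κ * primitiveSum c κ ≤ 8 * (a / δ) := by
      rw [← mul_div_assoc, div_mul_eq_mul_div, div_le_div_iff₀ hκ hδ]
      nlinarith
    have h8 : a / (1 + δ) ≤ a / (2 * δ) :=
      div_le_div_of_nonneg_left (by linarith) (by positivity) (by linarith)
    have h9 : a / (2 * δ) = a / δ / 2 := by field_simp
    have h10 : 17 * a / δ = 17 * (a / δ) := by ring
    have h11 : 0 ≤ a / (1 + δ) := div_nonneg (by linarith) (by linarith)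
    rw [h3, h10, h9, one_mul, one_mul]
    constructor <;> linarith
  · have ha : a = -lambertSum c κ := by
      have h1 := hFE 1 one_pos
      norm_num at h1
      linarith
    have hT := lambertSum_pos hc hκ
    refine ⟨lambertSum c κ, hT, fun δ hδ hδ1 hδκ => ?_⟩
    obtain ⟨h1, h2, h3⟩ := integral_lambertSum_eq (abs_le_one_of_values hc) hκ hδ hFE
    obtain ⟨h4, h5⟩ := hmono δ hδ
    have h6 := integral_rpow_mul_lambertSum_le_lambertSum hc hκ hδ hδκ h1
    have h7 : 2 / κ * lambertSum c κ ≤ lambertSum c κ / δ := by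
      rw [div_mul_eq_mul_div, div_le_div_iff₀ hκ hδ]
      nlinarith
    have h8 : lambertSum c κ / (1 + δ) ≤ lambertSum c κ / δ :=
      div_le_div_of_nonneg_left hT.le hδ (by linarith)
    have h9 : lambertSum c κ / (2 * δ) = lambertSum c κ / δ / 2 := by field_simp
    have h10 : 17 * lambertSum c κ / δ = 17 * (lambertSum c κ / δ) := by ring
    have h11 : 0 ≤ lambertSum c κ / (1 + δ) := by positivity
    have h12 : 0 ≤ lambertSum c κ / δ := by positivity
    rw [h3, h10, h9, ha, neg_one_mul, neg_one_mul, neg_neg, neg_div, sub_neg_eq_add]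
    constructor <;> linarith

lemma exists_Gamma_bounds : ∃ g : ℝ, 0 < g ∧ g ≤ 1 ∧ ∀ δ : ℝ, 0 < δ → δ ≤ 1 →
    g ≤ Real.Gamma (1 + δ) ∧ Real.Gamma (1 + δ) ≤ 1 / g := by
  have hcont : ContinuousOn Real.Gamma (Icc 1 2) := fun x hx =>
    (Real.differentiableAt_Gamma fun m => by
      have : (0 : ℝ) ≤ m := m.cast_nonneg
      linarith [hx.1]).continuousAt.continuousWithinAt
  have hpos (x : ℝ) (hx : x ∈ Icc (1 : ℝ) 2) : 0 < Real.Gamma x :=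
    Real.Gamma_pos_of_pos (by linarith [hx.1])
  have hne : (Icc (1 : ℝ) 2).Nonempty := ⟨1, by norm_num⟩
  obtain ⟨u, hu, hu'⟩ := isCompact_Icc.exists_isMinOn hne hcont
  obtain ⟨v, hv, hv'⟩ := isCompact_Icc.exists_isMaxOn hne hcont
  have h0 := hpos u hu
  have h1 := hpos v hv
  refine ⟨min (min (Real.Gamma u) (1 / Real.Gamma v)) 1, by positivity, min_le_right _ _,
    fun δ hδ hδ1 => ?_⟩
  have hm : 1 + δ ∈ Icc (1 : ℝ) 2 := ⟨by linarith, by linarith⟩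
  refine ⟨((min_le_left _ _).trans (min_le_left _ _)).trans (hu' hm), (hv' hm).trans ?_⟩
  rw [le_div_iff₀ (by positivity), ← le_div_iff₀' h1]
  exact (min_le_left _ _).trans (min_le_right _ _)

lemma rpow_bounds (hκ : 0 < κ) (hκ7 : κ ≤ 7) (hδ : 0 < δ) (hδ1 : δ ≤ 1) (hδκ : δ ≤ κ / 2) :
    1 / 2 ≤ κ ^ δ ∧ κ ^ δ ≤ 7 := by
  constructor
  · rw [Real.rpow_def_of_pos hκ]
    have h1 : -(1 / 2) ≤ Real.log κ * δ := by
      have h2 := Real.one_sub_inv_le_log_of_pos hκ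
      rcases le_or_gt 1 κ with h | h
      · have := mul_nonneg (Real.log_nonneg h) hδ.le
        linarith
      · have h3 := Real.log_neg hκ h
        have h4 : (1 - κ⁻¹) * κ = κ - 1 := by field_simp
        nlinarith
    linarith [Real.add_one_le_exp (Real.log κ * δ)]
  · calc κ ^ δ ≤ 7 ^ δ := Real.rpow_le_rpow hκ.le hκ7 hδ.le
      _ ≤ 7 ^ (1 : ℝ) := Real.rpow_le_rpow_of_exponent_le (by norm_num) hδ1
      _ = 7 := Real.rpow_one _

/-- The logarithm of `L(1 + δ)` varies by at most an absolute constant for `δ ≤ κ / 2`. -/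
lemma exists_abs_log_tsum_sub_log_tsum_le : ∃ C : ℝ, ∀ (c : ℕ →*₀ ℝ) (a W κ : ℝ),
    (∀ n, c n = 0 ∨ c n = 1 ∨ c n = -1) → 0 < κ → κ ≤ 7 →
    (∀ t : ℝ, 0 < t → a + lambertSum c (κ * (1 / t)) = W * t * (a + lambertSum c (κ * t))) →
    ∀ δ δ' : ℝ, 0 < δ → δ ≤ 1 → δ ≤ κ / 2 → 0 < δ' → δ' ≤ 1 → δ' ≤ κ / 2 →
    |Real.log (∑' n : ℕ, c n * (n : ℝ) ^ (-(1 + δ))) -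
      Real.log (∑' n : ℕ, c n * (n : ℝ) ^ (-(1 + δ')))| ≤ C := by
  obtain ⟨g, hg, hg1, hΓ⟩ := exists_Gamma_bounds
  refine ⟨Real.log (119 / g) - Real.log (g / 8), fun c a W κ hc hκ hκ7 hFE => ?_⟩
  obtain ⟨A, hA, hΛ⟩ := exists_integral_lambertSum_bounds hc hκ hFE
  have key (δ : ℝ) (hδ : 0 < δ) (hδ1 : δ ≤ 1) (hδκ : δ ≤ κ / 2) :
      Real.log (A * κ) + Real.log (g / 8) ≤
        Real.log (∑' n : ℕ, c n * (n : ℝ) ^ (-(1 + δ))) ∧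
      Real.log (∑' n : ℕ, c n * (n : ℝ) ^ (-(1 + δ))) ≤
        Real.log (A * κ) + Real.log (119 / g) := by
    obtain ⟨hl, hu⟩ := hΛ δ hδ hδ1 hδκ
    have hM := (integral_rpow_mul_lambertSum (abs_le_one_of_values hc) hκ
      (s := 1 + δ) (by linarith)).2
    obtain ⟨hg2, hg3⟩ := hΓ δ hδ hδ1
    obtain ⟨hr1, hr2⟩ := rpow_bounds hκ hκ7 hδ hδ1 hδκ
    have hz1 := inv_le_tsum_rpow_neg hδ
    have hz2 := tsum_rpow_neg_le hδ
    rw [add_sub_cancel_left] at hM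
    rw [hM, Real.rpow_neg hκ.le, Real.rpow_add hκ, Real.rpow_one] at hl hu
    set Z := ∑' n : ℕ+, (n : ℝ) ^ (-(1 + δ))
    set L := ∑' n : ℕ, c n * (n : ℝ) ^ (-(1 + δ))
    set G := Real.Gamma (1 + δ)
    set r := κ ^ δ
    have hG : 0 < G := hg.trans_le hg2
    have hr : 0 < r := by linarith
    have hZ : 0 < Z := lt_of_lt_of_le (by positivity) hz1
    have hδZ1 : 1 ≤ δ * Z := by rwa [div_le_iff₀' hδ] at hz1
    have hδZ2 : δ * Z ≤ 2 := by
      have := mul_le_mul_of_nonneg_left hz2 hδ.le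
      rw [mul_add, mul_one_div_cancel hδ.ne'] at this
      linarith
    have hP : 0 < G * (κ * r)⁻¹ * (δ * Z) := by positivity
    have e : G * (κ * r)⁻¹ * (Z * L) * δ = G * (κ * r)⁻¹ * (δ * Z) * L := by ring
    rw [div_le_iff₀ (by positivity), show ∀ x : ℝ, x * (2 * δ) = 2 * (x * δ) by intro x; ring,
      e] at hl
    rw [le_div_iff₀ hδ, e] at hu
    have hP1 : G * (κ * r)⁻¹ * (δ * Z) ≤ 4 / (g * κ) := by
      calc G * (κ * r)⁻¹ * (δ * Z) ≤ (1 / g) * (κ * (1 / 2))⁻¹ * 2 := by gcongr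
        _ = 4 / (g * κ) := by field_simp; norm_num
    have hP2 : g / (7 * κ) ≤ G * (κ * r)⁻¹ * (δ * Z) := by
      calc g / (7 * κ) = g * (κ * 7)⁻¹ * 1 := by field_simp
        _ ≤ G * (κ * r)⁻¹ * (δ * Z) := by gcongr
    have hL : 0 < L := by
      by_contra h
      nlinarith
    have hL1 : A * κ * (g / 8) ≤ L := by
      have h1 : A ≤ 2 * (4 / (g * κ) * L) :=
        hl.trans (mul_le_mul_of_nonneg_left (mul_le_mul_of_nonneg_right hP1 hL.le) two_pos.le)
      have h2 : 2 * (4 / (g * κ) * L) = L / (κ * (g / 8)) := by field_simp; norm_num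
      rw [h2, le_div_iff₀ (by positivity)] at h1
      linarith
    have hL2 : L ≤ A * κ * (119 / g) := by
      have h1 : g / (7 * κ) * L ≤ 17 * A := (mul_le_mul_of_nonneg_right hP2 hL.le).trans hu
      rw [div_mul_eq_mul_div, div_le_iff₀ (by positivity)] at h1
      rw [← mul_div_assoc, le_div_iff₀ hg]
      linarith
    rw [← Real.log_mul (by positivity) (by positivity),
      ← Real.log_mul (by positivity) (by positivity)]
    exact ⟨Real.log_le_log (by positivity) hL1, Real.log_le_log hL hL2⟩
  intro δ δ' h1 h2 h3 h4 h5 h6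
  obtain ⟨k1, k2⟩ := key δ h1 h2 h3
  obtain ⟨k3, k4⟩ := key δ' h4 h5 h6
  rw [abs_le]
  constructor <;> linarith

end

lemma abs_sum_primes_Ioc_le {c : ℕ →*₀ ℝ} {C y z : ℝ} (hy : Real.exp 1 ≤ y) (hyz : y ≤ z)
    (hC : ∀ δ : ℝ, 0 < δ → δ ≤ 1 / Real.log y →
      |Real.log (∑' n : ℕ, c n * (n : ℝ) ^ (-(1 + δ))) -
        ∑ p ∈ (Finset.range (⌊Real.exp (1 / δ)⌋₊ + 1)).filter Nat.Prime, c p / p| ≤ C)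
    {C' : ℝ} (hC' : ∀ δ δ' : ℝ, 0 < δ → δ ≤ 1 / Real.log y → 0 < δ' → δ' ≤ 1 / Real.log y →
      |Real.log (∑' n : ℕ, c n * (n : ℝ) ^ (-(1 + δ))) -
        Real.log (∑' n : ℕ, c n * (n : ℝ) ^ (-(1 + δ')))| ≤ C') :
    |∑ p ∈ (Finset.range (⌊z⌋₊ + 1)).filter (fun p : ℕ => p.Prime ∧ y < (p : ℝ)), c p / p| ≤
      2 * C + C' := by
  have hy0 : 0 < y := (Real.exp_pos 1).trans_le hy
  have hlog : 0 < Real.log y :=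
    zero_lt_one.trans_le ((Real.le_log_iff_exp_le hy0).mpr hy)
  have hlog' : Real.log y ≤ Real.log z := Real.log_le_log hy0 hyz
  have e : ∑ p ∈ (Finset.range (⌊z⌋₊ + 1)).filter (fun p : ℕ => p.Prime ∧ y < (p : ℝ)), c p / p =
      ∑ p ∈ (Finset.range (⌊z⌋₊ + 1)).filter Nat.Prime, c p / p -
      ∑ p ∈ (Finset.range (⌊y⌋₊ + 1)).filter Nat.Prime, c p / p := by
    rw [eq_sub_iff_add_eq, ← Finset.sum_union]
    · refine Finset.sum_congr ?_ fun _ _ => rfl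
      ext p
      have h1 := Nat.floor_le_floor hyz
      have h2 : y < (p : ℝ) ↔ ⌊y⌋₊ < p := (Nat.floor_lt hy0.le).symm
      simp only [Finset.mem_union, Finset.mem_filter, Finset.mem_range, h2]
      constructor
      · rintro (h | h)
        · exact ⟨h.1, h.2.1⟩
        · exact ⟨by omega, h.2⟩
      · rintro ⟨h3, h4⟩
        rcases lt_or_ge ⌊y⌋₊ p with h | h
        · exact Or.inl ⟨h3, h4, h⟩
        · exact Or.inr ⟨by omega, h4⟩
    · rw [Finset.disjoint_left]
      intro p h1 h2
      simp only [Finset.mem_filter, Finset.mem_range] at h1 h2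
      have := (Nat.floor_lt hy0.le).mpr h1.2.2
      omega
  have hδ' : 1 / Real.log z ≤ 1 / Real.log y := one_div_le_one_div_of_le hlog hlog'
  have hz : 0 < 1 / Real.log z := by have := hlog.trans_le hlog'; positivity
  have h1 := hC _ (by positivity) le_rfl
  have h2 := hC _ hz hδ'
  have h3 := hC' _ _ (by positivity) le_rfl hz hδ'
  rw [one_div_one_div, Real.exp_log (by linarith)] at h1 h2
  rw [e]
  rw [abs_le] at *
  constructor <;> linarith

/-- There is an effective absolute constant `C > 0` such that for every
fundamental quadratic discriminant `Δ < 0` with associated Kronecker symbol `χ = (Δ/·)`,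
and every real `y ≥ exp(√|Δ|)`, the tail of the convergent series satisfies
`|∑_{p > y} χ(p)/p| ≤ C`.  The tail is expressed as the limit of its partial sums. -/
theorem tail_sum_chi_div_p_bounded :
    ∃ C : ℝ, 0 < C ∧
      ∀ Δ : ℤ, Δ < 0 → IsFundamentalDiscriminant Δ →
        ∀ y : ℝ, Real.exp (Real.sqrt |(Δ : ℝ)|) ≤ y → ∀ S : ℝ,
          Filter.Tendsto
            (fun N : ℕ => ∑ p ∈ (Finset.range N).filter (fun p : ℕ => p.Prime ∧ y < (p : ℝ)),
              (kroneckerAtPrime Δ p : ℝ) / p)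
            Filter.atTop (nhds S) →
          |S| ≤ C := by
  obtain ⟨C, hC⟩ := exists_abs_log_tsum_sub_sum_primes_le
  obtain ⟨C', hC'⟩ := exists_abs_log_tsum_sub_log_tsum_le
  refine ⟨max (2 * C + C') 1, by positivity, fun Δ hΔ _ y hy S hS => le_max_of_le_left ?_⟩
  obtain ⟨q, c, W, hq, hqΔ, hc, hcΔ, hW⟩ := exists_quadratic_data hΔ
  obtain ⟨a, hFE⟩ := exists_lambertSum_functional_equation (abs_le_one_of_values hc) hq hW
  have hq1 : (1 : ℝ) ≤ q := by exact_mod_cast hq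
  have habs : |(Δ : ℝ)| = (Δ.natAbs : ℝ) := by rw [Nat.cast_natAbs, Int.cast_abs]
  have hD1 : (1 : ℝ) ≤ Δ.natAbs := by
    exact_mod_cast Int.natAbs_pos.mpr hΔ.ne
  rw [habs] at hy
  set D : ℝ := (Δ.natAbs : ℝ)
  have hsD : 1 ≤ √D := Real.one_le_sqrt.mpr hD1
  have hsq : 1 ≤ √(q : ℝ) := Real.one_le_sqrt.mpr hq1
  have hsqD : √(q : ℝ) ≤ 2 * √D := by
    rw [Real.sqrt_le_left (by positivity), mul_pow, Real.sq_sqrt (by positivity)]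
    have : (q : ℝ) ≤ 4 * Δ.natAbs := by exact_mod_cast hqΔ
    linarith
  have hye : Real.exp 1 ≤ y := (Real.exp_le_exp.mpr hsD).trans hy
  have hy0 : 0 < y := (Real.exp_pos 1).trans_le hye
  have hlog : √D ≤ Real.log y := (Real.le_log_iff_exp_le hy0).mpr hy
  have hπ := Real.pi_gt_three
  set κ := 2 * Real.pi / √(q : ℝ) with hκdef
  have hκ : 0 < κ := by positivity
  have hκ7 : κ ≤ 7 := by
    rw [hκdef, div_le_iff₀ (by positivity)]
    linarith [Real.pi_lt_d2]
  have hFE' : ∀ t : ℝ, 0 < t →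
      a + lambertSum c (κ * (1 / t)) = W * t * (a + lambertSum c (κ * t)) := fun t ht => by
    have h := hFE t ht
    rwa [mul_div_right_comm (2 * Real.pi), mul_div_right_comm (2 * Real.pi)] at h
  have hδ (δ : ℝ) (h : δ ≤ 1 / Real.log y) : δ ≤ 1 ∧ δ ≤ κ / 2 := by
    have h1 : δ ≤ 1 / √D := h.trans (one_div_le_one_div_of_le (by positivity) hlog)
    refine ⟨h1.trans (by rw [div_le_one (by positivity)]; exact hsD), h1.trans ?_⟩
    rw [hκdef, div_div, div_le_div_iff₀ (by positivity) (by positivity)]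
    nlinarith
  refine le_of_tendsto ((Filter.tendsto_add_atTop_iff_nat 1).mpr hS).abs ?_
  filter_upwards [Filter.eventually_ge_atTop ⌈y⌉₊] with N hN
  have h1 := abs_sum_primes_Ioc_le (c := c) (C := C) (C' := C') hye (z := N)
    (Nat.ceil_le.mp hN)
    (fun δ h h' => (hC c (abs_le_one_of_values hc) δ h (hδ δ h').1).2)
    (fun δ δ' h h' h2 h2' => hC' c a W κ hc hκ hκ7 hFE' δ δ' h (hδ δ h').1 (hδ δ h').2
      h2 (hδ δ' h2').1 (hδ δ' h2').2)
  rw [Nat.floor_natCast] at h1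
  refine (congrArg abs (Finset.sum_congr rfl fun p hp => ?_)).trans_le h1
  obtain ⟨-, hp, hyp⟩ := Finset.mem_filter.mp hp
  have hexp2 : 2 < Real.exp 1 := by linarith [Real.exp_one_gt_d9]
  have hp2 : p ≠ 2 := by
    rintro rfl
    push_cast at hyp
    linarith
  have hDp : Δ.natAbs < p := by
    have h2 : D < Real.exp √D := by
      have h4 := Real.sq_sqrt (show 0 ≤ D by positivity)
      have h7 := Real.add_one_le_exp (√D / 2 - 1)
      have h8 : Real.exp √D = Real.exp 1 ^ 2 * Real.exp (√D / 2 - 1) ^ 2 := by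
        rw [← Real.exp_nat_mul, ← Real.exp_nat_mul, ← Real.exp_add]; push_cast; ring_nf
      have h9 : (√D / 2) ^ 2 ≤ Real.exp (√D / 2 - 1) ^ 2 := by
        apply pow_le_pow_left₀ (by positivity); linarith
      have h10 : 4 < Real.exp 1 ^ 2 := by nlinarith
      nlinarith
    exact Nat.cast_lt.mp (h2.trans (hy.trans_lt hyp))
  have hcop : p.Coprime (4 * Δ.natAbs) := by
    rw [Nat.Prime.coprime_iff_not_dvd hp, hp.dvd_mul]
    rintro (h | h)
    · exact hp2 ((Nat.prime_dvd_prime_iff_eq hp Nat.prime_two).mp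
        (hp.dvd_of_dvd_pow (n := 2) h))
    · exact absurd (Nat.le_of_dvd (Int.natAbs_pos.mpr hΔ.ne) h) (not_le.mpr hDp)
  rw [hcΔ p hcop, kroneckerAtPrime, if_neg hp2]
end

section
/- There is an effective absolute constant C > 0 such that for every imaginary quadratic field K with ring of integers O_K and class number h_K, and every real z ≥ 2, one has ∏_{𝔭 prime ideal of O_K, |𝔭| ≤ z} (1 − 1/|𝔭|) ≥ C / (h_K · log z). -/
open NumberField

lemma sum_mul_le_of_partial_sums_le {c g : ℕ → ℝ} {A : ℝ} (hg : Antitone g) (hg0 : ∀ n, 0 ≤ g n)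
    (hc : ∀ n : ℕ, ∑ i ∈ Finset.range n, c i ≤ A * n) (N : ℕ) :
    ∑ i ∈ Finset.range N, c i * g i ≤ A * ∑ i ∈ Finset.range N, g i := by
  have key : ∀ N : ℕ, (A * N - ∑ i ∈ Finset.range N, c i) * g N ≤
      A * ∑ i ∈ Finset.range N, g i - ∑ i ∈ Finset.range N, c i * g i := by
    intro N
    induction N with
    | zero => simp
    | succ N ih =>
      have h1 := mul_le_mul_of_nonneg_left (hg N.le_succ) (sub_nonneg.2 (hc (N + 1)))
      simp only [Finset.sum_range_succ, Nat.succ_eq_add_one] at h1 ⊢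
      push_cast at h1 ⊢
      nlinarith
  have := key N
  have := mul_nonneg (sub_nonneg.2 (hc N)) (hg0 N)
  linarith

lemma sum_rpow_neg_le {s : ℝ} (hs : 0 < s) (N : ℕ) :
    ∑ i ∈ Finset.range N, ((i : ℝ) + 1) ^ (-(1 + s)) ≤ 1 + 1 / s := by
  have key : ∀ N : ℕ, ∑ i ∈ Finset.range (N + 1), ((i : ℝ) + 1) ^ (-(1 + s)) ≤
      1 + 1 / s - ((N : ℝ) + 1) ^ (-s) / s := by
    intro N
    induction N with
    | zero => simp
    | succ N ih =>
      rw [Finset.sum_range_succ]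
      push_cast
      set m : ℝ := (N : ℝ) + 1 with hm
      have hm0 : 0 < m := by positivity
      have hlog : 1 / (m + 1) ≤ Real.log (m + 1) - Real.log m := by
        have := Real.one_sub_inv_le_log_of_pos (x := (m + 1) / m) (by positivity)
        rw [Real.log_div (by positivity) (by positivity)] at this
        refine le_trans (le_of_eq ?_) this
        field_simp
        ring
      have h1 : m ^ (-s) = (m + 1) ^ (-s) * Real.exp (s * (Real.log (m + 1) - Real.log m)) := by
        rw [Real.rpow_def_of_pos hm0, Real.rpow_def_of_pos (by positivity), ← Real.exp_add]
        ring_nf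
      have h2 : 1 + s * (1 / (m + 1)) ≤ Real.exp (s * (Real.log (m + 1) - Real.log m)) := by
        have := Real.add_one_le_exp (s * (Real.log (m + 1) - Real.log m))
        have := mul_le_mul_of_nonneg_left hlog hs.le
        linarith
      have h3 : (m + 1) ^ (-(1 + s)) = (m + 1) ^ (-s) * (1 / (m + 1)) := by
        rw [show -(1 + s) = -s + -1 by ring, Real.rpow_add (by positivity), Real.rpow_neg_one]
        simp
      have ha : 0 < (m + 1) ^ (-s) := by positivity
      have h4 := mul_le_mul_of_nonneg_left h2 ha.le
      rw [← h1] at h4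
      have h5 : (m + 1) ^ (-(1 + s)) ≤ m ^ (-s) / s - (m + 1) ^ (-s) / s := by
        rw [h3, ← sub_div, le_div_iff₀ hs]
        nlinarith
      linarith
  cases N with
  | zero => simp; positivity
  | succ N =>
    have : 0 ≤ ((N : ℝ) + 1) ^ (-s) / s := by positivity
    linarith [key N]

lemma sum_log_div_le (N : ℕ) :
    ∑ p ∈ N.primesLE, Real.log p / p ≤ Real.log 4 * (1 + Real.log N) := by
  have h := sum_mul_le_of_partial_sums_le (c := fun i => if (i + 1).Prime then Real.log (i + 1 : ℕ)
    else 0) (g := fun i => ((i : ℝ) + 1)⁻¹) (A := Real.log 4)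
    (fun a b hab => by dsimp only; gcongr) (fun n => by positivity) (fun n => ?_) N
  · have h1 := harmonic_le_one_add_log N
    have h2 : (harmonic N : ℝ) = ∑ i ∈ Finset.range N, ((i : ℝ) + 1)⁻¹ := by
      simp [harmonic]
    rw [h2] at h1
    refine le_trans (le_of_eq ?_) (h.trans (mul_le_mul_of_nonneg_left h1
      (Real.log_nonneg (by norm_num))))
    rw [Nat.primesLE_eq_filter_range, Finset.sum_filter, Finset.sum_range_succ']
    simp [div_eq_mul_inv]
  · have h1 := Chebyshev.theta_le_log4_mul_x (x := n) (by positivity)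
    rw [Chebyshev.theta_eq_sum_primesLE_log, Nat.primesLE_eq_filter_range, Finset.sum_filter,
      Finset.sum_range_succ'] at h1
    simpa using h1

lemma prod_geom_sum_eq_sum {M : Type*} [CommMonoidWithZero M] [IsCancelMulZero M] [Nontrivial M]
    [Subsingleton Mˣ]
    (w : M →* ℝ) (k : ℕ) (S : Finset M) (hS : ∀ p ∈ S, Prime p) :
    ∃ F : Finset M, (∀ x ∈ F, x ≠ 0) ∧ (∀ x ∈ F, ∀ q, Prime q → q ∣ x → q ∈ S) ∧
      ∏ p ∈ S, ∑ j ∈ Finset.range k, w p ^ j = ∑ x ∈ F, w x := by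
  classical
  induction S using Finset.induction_on with
  | empty =>
    refine ⟨{1}, by simp, ?_, by simp⟩
    intro x hx q hq hqx
    rw [Finset.mem_singleton] at hx
    subst hx
    exact absurd (isUnit_of_dvd_one hqx) hq.not_isUnit
  | insert q S hq ih =>
    obtain ⟨F, hF0, hFS, hF⟩ := ih fun p hp => hS p (Finset.mem_insert_of_mem hp)
    have hqp : Prime q := hS q (Finset.mem_insert_self _ _)
    have hndvd : ∀ x ∈ F, ¬ q ∣ x := fun x hx h => hq (hFS x hx q hqp h)
    have aux : ∀ i j : ℕ, ∀ x ∈ F, ∀ y ∈ F, q ^ i * x = q ^ j * y → j ≤ i := by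
      intro i j x hx y hy h
      by_contra! hij
      obtain ⟨d, rfl⟩ := Nat.exists_eq_add_of_lt hij
      rw [add_assoc, pow_add, mul_assoc] at h
      have := mul_left_cancel₀ (pow_ne_zero i hqp.ne_zero) h
      apply hndvd x hx
      rw [this, pow_succ']
      exact ⟨q ^ d * y, by rw [mul_assoc]⟩
    refine ⟨(Finset.range k ×ˢ F).image fun a => q ^ a.1 * a.2, ?_, ?_, ?_⟩
    · simp only [Finset.mem_image, Finset.mem_product]
      rintro _ ⟨a, ha, rfl⟩
      exact mul_ne_zero (pow_ne_zero _ hqp.ne_zero) (hF0 _ ha.2)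
    · simp only [Finset.mem_image, Finset.mem_product]
      rintro _ ⟨a, ha, rfl⟩ r hr hra
      rcases hr.dvd_or_dvd hra with h | h
      · have := hr.dvd_of_dvd_pow h
        rw [associated_iff_eq.1 (hr.associated_of_dvd hqp this)]
        exact Finset.mem_insert_self _ _
      · exact Finset.mem_insert_of_mem (hFS _ ha.2 r hr h)
    · rw [Finset.prod_insert hq, hF, Finset.sum_mul_sum, ← Finset.sum_product', Finset.sum_image]
      · simp
      · rintro ⟨i, x⟩ ha ⟨j, y⟩ hb h
        simp only [Finset.coe_product, Set.mem_prod, Finset.mem_coe] at ha hb h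
        have hij : i = j := le_antisymm (aux j i y hb.2 x ha.2 h.symm) (aux i j x ha.2 y hb.2 h)
        subst hij
        rw [mul_left_cancel₀ (pow_ne_zero i hqp.ne_zero) h]

lemma prod_one_sub_inv_le {M : Type*} [CommMonoidWithZero M] [IsCancelMulZero M] [Nontrivial M]
    [Subsingleton Mˣ]
    (w : M →* ℝ) {B : ℝ} (hB : ∀ F : Finset M, (∀ x ∈ F, x ≠ 0) → ∑ x ∈ F, w x ≤ B)
    (S : Finset M) (hS : ∀ p ∈ S, Prime p) (h0 : ∀ p ∈ S, 0 ≤ w p) (h1 : ∀ p ∈ S, w p < 1) :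
    ∏ p ∈ S, (1 - w p)⁻¹ ≤ B := by
  have ht : Filter.Tendsto (fun k => ∏ p ∈ S, ∑ j ∈ Finset.range k, w p ^ j) Filter.atTop
      (nhds (∏ p ∈ S, (1 - w p)⁻¹)) :=
    tendsto_finsetProd _ fun p hp =>
      (hasSum_geometric_of_lt_one (h0 p hp) (h1 p hp)).tendsto_sum_nat
  refine le_of_tendsto' ht fun k => ?_
  obtain ⟨F, hF0, -, hF⟩ := prod_geom_sum_eq_sum w k S hS
  rw [hF]
  exact hB F hF0

lemma Complex.card_le_of_separated {r R : ℝ} (hr : 0 < r) (hrR : r ≤ R) (T : Finset ℂ)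
    (hsep : ∀ x ∈ T, ∀ y ∈ T, x ≠ y → r ≤ ‖x - y‖) (hR : ∀ x ∈ T, ‖x‖ ≤ R) :
    (T.card : ℝ) ≤ 36 * (R / r) ^ 2 := by
  set y := 2 * (R / r) with hy
  have hy2 : 2 ≤ y := by
    have : 1 ≤ R / r := (one_le_div hr).2 hrR
    linarith
  set n : ℤ := ⌊y⌋
  have hny : (n : ℝ) ≤ y := Int.floor_le y
  have hn2 : 2 ≤ n := Int.le_floor.2 (by exact_mod_cast hy2)
  have hmem : ∀ u : ℝ, |u| ≤ R → ⌊2 * (u / r)⌋ ∈ Finset.Icc (-(n + 1)) n := by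
    intro u hu
    have h1 := abs_le.1 hu
    have h2 : 2 * (u / r) ≤ y := by rw [hy]; gcongr; exact h1.2
    have h3 : -y ≤ 2 * (u / r) := by
      rw [hy, ← mul_neg, ← neg_div]; gcongr; exact h1.1
    rw [Finset.mem_Icc]
    refine ⟨Int.le_floor.2 ?_, Int.floor_le_floor h2⟩
    push_cast
    linarith [Int.lt_floor_add_one y]
  have hcard : T.card ≤ (Finset.Icc (-(n + 1)) n ×ˢ Finset.Icc (-(n + 1)) n).card := by
    refine Finset.card_le_card_of_injOn
      (fun x : ℂ => (⌊2 * (x.re / r)⌋, ⌊2 * (x.im / r)⌋)) ?_ ?_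
    · intro x hx
      exact Finset.mem_coe.2 (Finset.mem_product.2
        ⟨hmem _ ((Complex.abs_re_le_norm x).trans (hR x hx)),
         hmem _ ((Complex.abs_im_le_norm x).trans (hR x hx))⟩)
    · intro x hx z hz h
      by_contra hne
      have hs := hsep x hx z hz hne
      simp only [Prod.mk.injEq] at h
      have hre := Int.abs_sub_lt_one_of_floor_eq_floor h.1
      have him := Int.abs_sub_lt_one_of_floor_eq_floor h.2
      rw [← mul_sub, ← sub_div, ← mul_div_assoc, abs_div, abs_of_pos hr, div_lt_one hr, abs_mul,
        abs_two] at hre him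
      have hn := Complex.norm_le_abs_re_add_abs_im (x - z)
      simp only [Complex.sub_re, Complex.sub_im] at hn
      linarith
  rw [Finset.card_product, Int.card_Icc] at hcard
  have hc : (((n + 1 - -(n + 1)).toNat : ℕ) : ℝ) = 2 * n + 2 := by
    have : (((n + 1 - -(n + 1)).toNat : ℕ) : ℤ) = 2 * n + 2 := by omega
    exact_mod_cast this
  have hcard' : (T.card : ℝ) ≤ (2 * n + 2) * (2 * n + 2) := by
    rw [← hc]; exact_mod_cast hcard
  have hn0 : (2 : ℝ) ≤ n := by exact_mod_cast hn2
  have : R / r = y / 2 := by rw [hy]; ring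
  rw [this]
  nlinarith

lemma log_absNorm_div_le {R : Type*} [CommRing R] [IsDedekindDomain R] [Module.Free ℤ R]
    [Module.Finite ℤ R] (P : Ideal R) [P.IsPrime] [NeZero P] :
    Real.log P.absNorm / P.absNorm ≤
      Real.log (P.under ℤ).absNorm / (P.under ℤ).absNorm := by
  have hp := Nat.absNorm_under_prime P
  obtain ⟨f, hf0, hf⟩ : ∃ f, f ≠ 0 ∧ P.absNorm = (P.under ℤ).absNorm ^ f :=
    ⟨P.inertiaDeg ℤ, (Ideal.inertiaDeg_pos P ℤ).ne',
      (Ideal.absNorm_pow_inertiaDeg (P.under ℤ) P).symm⟩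
  rw [hf]
  generalize (P.under ℤ).absNorm = p at hp
  obtain ⟨k, rfl⟩ := Nat.exists_eq_succ_of_ne_zero hf0
  have hk : ((k + 1 : ℕ) : ℝ) ≤ (p : ℝ) ^ k := by
    have h1 : k < 2 ^ k := Nat.lt_two_pow_self
    have h2 : 2 ^ k ≤ p ^ k := Nat.pow_le_pow_left hp.two_le k
    exact_mod_cast h1.trans_le h2
  have hp0 : (0 : ℝ) < p := by exact_mod_cast hp.pos
  have hlog : 0 ≤ Real.log p := Real.log_natCast_nonneg p
  push_cast [Nat.succ_eq_add_one] at hk ⊢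
  rw [Real.log_pow, pow_succ, div_le_div_iff₀ (by positivity) hp0]
  push_cast
  nlinarith [mul_le_mul_of_nonneg_right hk (mul_nonneg hlog hp0.le)]

lemma card_le_finrank_of_under_eq {R : Type*} [CommRing R] [IsDedekindDomain R] [Module.Free ℤ R]
    [Module.Finite ℤ R] {p : ℕ} (hp : p.Prime) (S : Finset (Ideal R))
    (hS : ∀ P ∈ S, P.IsPrime ∧ P ≠ ⊥) (hSp : ∀ P ∈ S, (P.under ℤ).absNorm = p) :
    S.card ≤ Module.finrank ℤ R := by
  have hd : ∏ P ∈ S, P ∣ Ideal.span {(p : R)} := by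
    refine Finset.prod_primes_dvd _ (fun P hP => ?_) fun P hP => ?_
    · exact Ideal.prime_of_isPrime (hS P hP).2 (hS P hP).1
    · rw [Ideal.dvd_span_singleton]
      have := Int.absNorm_under_mem P
      rwa [hSp P hP] at this
  have hN := map_dvd Ideal.absNorm hd
  rw [map_prod, Ideal.absNorm_span_natCast] at hN
  have hle := Nat.le_of_dvd (pow_pos hp.pos _) hN
  have hpow : p ^ S.card ≤ ∏ P ∈ S, P.absNorm := by
    rw [← Finset.prod_const]
    refine Finset.prod_le_prod' fun P hP => ?_
    have h0 : P.absNorm ≠ 0 := Ideal.absNorm_eq_zero_iff.not.2 (hS P hP).2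
    have := Int.absNorm_under_dvd_absNorm P
    rw [hSp P hP] at this
    exact Nat.le_of_dvd (Nat.pos_of_ne_zero h0) this
  exact (Nat.pow_le_pow_iff_right hp.one_lt).1 (hpow.trans hle)

lemma sum_log_absNorm_div_le {R : Type*} [CommRing R] [IsDedekindDomain R] [Module.Free ℤ R]
    [Module.Finite ℤ R] {Z : ℕ} (S : Finset (Ideal R))
    (hS : ∀ P ∈ S, P.IsPrime ∧ P ≠ ⊥) (hZ : ∀ P ∈ S, P.absNorm ≤ Z) :
    ∑ P ∈ S, Real.log P.absNorm / P.absNorm ≤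
      Module.finrank ℤ R * ∑ p ∈ Z.primesLE, Real.log p / p := by
  classical
  have hmaps : ∀ P ∈ S, (P.under ℤ).absNorm ∈ Z.primesLE := by
    intro P hP
    have := (hS P hP).1
    have : NeZero P := ⟨(hS P hP).2⟩
    have h0 : P.absNorm ≠ 0 := Ideal.absNorm_eq_zero_iff.not.2 (hS P hP).2
    exact Nat.mem_primesLE.2 ⟨(Nat.le_of_dvd (Nat.pos_of_ne_zero h0)
      (Int.absNorm_under_dvd_absNorm P)).trans (hZ P hP), Nat.absNorm_under_prime P⟩
  rw [← Finset.sum_fiberwise_of_maps_to hmaps, Finset.mul_sum]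
  refine Finset.sum_le_sum fun p hp => ?_
  have hle : ∀ P ∈ S.filter (fun P => (P.under ℤ).absNorm = p),
      Real.log P.absNorm / P.absNorm ≤ Real.log p / p := by
    intro P hP
    rw [Finset.mem_filter] at hP
    have := (hS P hP.1).1
    have : NeZero P := ⟨(hS P hP.1).2⟩
    rw [← hP.2]
    exact log_absNorm_div_le P
  refine (Finset.sum_le_card_nsmul _ _ _ hle).trans ?_
  rw [nsmul_eq_mul]
  have hlog : 0 ≤ Real.log p / p := div_nonneg (Real.log_natCast_nonneg p) (by positivity)
  refine mul_le_mul_of_nonneg_right ?_ hlog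
  have := card_le_finrank_of_under_eq (Nat.mem_primesLE.1 hp).2
    (S.filter (fun P => (P.under ℤ).absNorm = p))
    (fun P hP => hS P (Finset.mem_filter.1 hP).1) (fun P hP => (Finset.mem_filter.1 hP).2)
  exact_mod_cast this

lemma exists_embedding_norm_sq_eq {K : Type*} [Field K] [NumberField K]
    (h2 : Module.finrank ℚ K = 2) (hK : IsEmpty (K →+* ℝ)) :
    ∃ φ : K →+* ℂ, ∀ x : 𝓞 K, ‖φ x‖ ^ 2 = ((Ideal.span {x}).absNorm : ℝ) := by
  have hC : IsTotallyComplex K := ⟨fun v => InfinitePlace.not_isReal_iff_isComplex.1 fun hv =>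
    hK.false (InfinitePlace.embedding_of_isReal hv)⟩
  have hcard : Fintype.card (InfinitePlace K) = 1 := by
    have h := IsTotallyComplex.finrank K
    have h' := InfinitePlace.card_eq_nrRealPlaces_add_nrComplexPlaces K
    rw [IsTotallyComplex.nrRealPlaces_eq_zero] at h'
    omega
  obtain ⟨v, hv⟩ := Fintype.card_eq_one_iff.1 hcard
  refine ⟨v.embedding, fun x => ?_⟩
  have h := InfinitePlace.prod_eq_abs_norm (x : K)
  have : Unique (InfinitePlace K) := ⟨⟨v⟩, hv⟩
  rw [Fintype.prod_unique, IsTotallyComplex.mult_eq, hv default] at h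
  rw [InfinitePlace.norm_embedding_eq, h, Ideal.absNorm_span_singleton,
    ← Algebra.coe_norm_int]
  simp

open scoped nonZeroDivisors in
lemma card_ideals_in_class_le {K : Type*} [Field K] [NumberField K]
    (h2 : Module.finrank ℚ K = 2) (hK : IsEmpty (K →+* ℝ)) {X : ℝ} (hX : 1 ≤ X)
    (c : ClassGroup (𝓞 K)) (F : Finset (Ideal (𝓞 K))⁰) (hFc : ∀ I ∈ F, ClassGroup.mk0 I = c)
    (hFX : ∀ I ∈ F, ((I : Ideal (𝓞 K)).absNorm : ℝ) ≤ X) :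
    (F.card : ℝ) ≤ 36 * X := by
  classical
  obtain ⟨φ, hφ⟩ := exists_embedding_norm_sq_eq h2 hK
  obtain ⟨J, hJ⟩ := ClassGroup.mk0_surjective c⁻¹
  have hgen : ∀ I : (Ideal (𝓞 K))⁰, ∃ x : 𝓞 K, I ∈ F →
      (I : Ideal (𝓞 K)) * J = Ideal.span {x} := by
    intro I
    by_cases hI : I ∈ F
    · obtain ⟨x, -, hx⟩ := ClassGroup.mk0_eq_mk0_inv_iff.1
        (show ClassGroup.mk0 I = (ClassGroup.mk0 J)⁻¹ by rw [hJ, inv_inv, hFc I hI])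
      exact ⟨x, fun _ => hx⟩
    · exact ⟨0, fun h => absurd h hI⟩
  choose g hg using hgen
  set N : ℝ := ((J : Ideal (𝓞 K)).absNorm : ℝ) with hNdef
  have hN : 0 < N := Nat.cast_pos.2 (Ideal.absNorm_pos_of_nonZeroDivisors J)
  have hJ0 : (J : Ideal (𝓞 K)) ≠ 0 := nonZeroDivisors.ne_zero J.2
  have hmem : ∀ I ∈ F, g I ∈ (J : Ideal (𝓞 K)) := fun I hI => by
    rw [← Ideal.span_singleton_le_iff_mem, ← hg I hI]
    exact Ideal.mul_le_right
  have hinj : Set.InjOn (fun I => φ (g I)) F := by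
    intro I hI I' hI' h
    have h' : g I = g I' := RingOfIntegers.ext (φ.injective h)
    have := hg I hI
    rw [h', ← hg I' hI'] at this
    exact Subtype.ext (mul_right_cancel₀ hJ0 this)
  have hmain := Complex.card_le_of_separated (r := √N) (R := √(X * N)) (Real.sqrt_pos.2 hN)
    (Real.sqrt_le_sqrt (le_mul_of_one_le_left hN.le hX)) (F.image fun I => φ (g I)) ?_ ?_
  · rw [Finset.card_image_of_injOn hinj, ← Real.sqrt_div' _ hN.le, mul_div_cancel_right₀ _ hN.ne',
      Real.sq_sqrt (by linarith)] at hmain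
    exact hmain
  · simp only [Finset.mem_image]
    rintro _ ⟨I, hI, rfl⟩ _ ⟨I', hI', rfl⟩ hne
    have hsub : g I - g I' ∈ (J : Ideal (𝓞 K)) := sub_mem (hmem I hI) (hmem I' hI')
    have h0 : g I - g I' ≠ 0 := fun h => hne (by rw [sub_eq_zero.1 h])
    rw [← map_sub, ← map_sub, Real.sqrt_le_left (norm_nonneg _), hφ]
    have hpos : 0 < (Ideal.span {g I - g I'}).absNorm := Nat.pos_of_ne_zero
      (Ideal.absNorm_eq_zero_iff.not.2 (Ideal.span_singleton_eq_bot.not.2 h0))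
    exact Nat.cast_le.2 (Nat.le_of_dvd hpos (Ideal.absNorm_dvd_absNorm_of_le
      ((Ideal.span_singleton_le_iff_mem _).2 hsub)))
  · simp only [Finset.mem_image]
    rintro _ ⟨I, hI, rfl⟩
    refine Real.le_sqrt_of_sq_le ?_
    rw [hφ, ← hg I hI, map_mul]
    push_cast
    exact mul_le_mul_of_nonneg_right (hFX I hI) hN.le

open scoped nonZeroDivisors in
lemma card_ideals_le {K : Type*} [Field K] [NumberField K]
    (h2 : Module.finrank ℚ K = 2) (hK : IsEmpty (K →+* ℝ)) {X : ℝ} (hX : 1 ≤ X)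
    (F : Finset (Ideal (𝓞 K))) (hF0 : ∀ I ∈ F, I ≠ 0) (hFX : ∀ I ∈ F, (I.absNorm : ℝ) ≤ X) :
    (F.card : ℝ) ≤ 36 * classNumber K * X := by
  classical
  set G : Finset (Ideal (𝓞 K))⁰ := F.subtype (· ∈ (Ideal (𝓞 K))⁰) with hG
  have hcard : F.card = G.card := by
    rw [hG, Finset.card_subtype, Finset.filter_true_of_mem]
    exact fun I hI => mem_nonZeroDivisors_of_ne_zero (hF0 I hI)
  rw [hcard, Finset.card_eq_sum_card_fiberwise (f := ClassGroup.mk0) (t := Finset.univ)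
    (fun _ _ => by simp)]
  push_cast
  refine (Finset.sum_le_card_nsmul _ _ (36 * X) fun c _ =>
    card_ideals_in_class_le h2 hK hX c _ (fun I hI => (Finset.mem_filter.1 hI).2)
      fun I hI => hFX _ (Finset.mem_subtype.1 (Finset.mem_filter.1 hI).1)).trans (le_of_eq ?_)
  rw [nsmul_eq_mul, Finset.card_univ, classNumber]
  ring

lemma sum_absNorm_rpow_le {K : Type*} [Field K] [NumberField K]
    (h2 : Module.finrank ℚ K = 2) (hK : IsEmpty (K →+* ℝ)) {s : ℝ} (hs : 0 < s)
    (F : Finset (Ideal (𝓞 K))) (hF0 : ∀ I ∈ F, I ≠ 0) :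
    ∑ I ∈ F, (I.absNorm : ℝ) ^ (-(1 + s)) ≤ 36 * classNumber K * (1 + 1 / s) := by
  classical
  have hpos : ∀ I ∈ F, 0 < I.absNorm := fun I hI =>
    Nat.pos_of_ne_zero (Ideal.absNorm_eq_zero_iff.not.2 (hF0 I hI))
  have hfib : ∀ (n : ℕ) (G : Finset (Ideal (𝓞 K))), G ⊆ F → (∀ I ∈ G, I.absNorm ≤ n) →
      ∀ I ∈ G, I.absNorm - 1 ∈ Finset.range n := fun n G hG hn I hI => by
    have := hpos I (hG hI)
    have := hn I hI
    rw [Finset.mem_range]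
    omega
  set N := F.sup Ideal.absNorm
  have hN : ∀ I ∈ F, I.absNorm ≤ N := fun I hI => Finset.le_sup hI
  have h := sum_mul_le_of_partial_sums_le
    (c := fun i => ((F.filter fun I => I.absNorm - 1 = i).card : ℝ))
    (g := fun i => ((i : ℝ) + 1) ^ (-(1 + s))) (A := 36 * classNumber K)
    (fun a b hab => Real.rpow_le_rpow_of_nonpos (by positivity) (by gcongr) (by linarith))
    (fun n => by positivity) (fun n => ?_) N
  · rw [← Finset.sum_fiberwise_of_maps_to (hfib N F subset_rfl hN)]
    refine le_trans (le_of_eq ?_) (h.trans (mul_le_mul_of_nonneg_left (sum_rpow_neg_le hs N)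
      (by positivity)))
    refine Finset.sum_congr rfl fun i _ => ?_
    rw [← nsmul_eq_mul, ← Finset.sum_const]
    refine Finset.sum_congr rfl fun I hI => ?_
    rw [Finset.mem_filter] at hI
    have := hpos I hI.1
    have : I.absNorm = i + 1 := by omega
    rw [this]
    push_cast
    rfl
  · rcases Nat.eq_zero_or_pos n with rfl | hn
    · simp
    have hc := card_ideals_le h2 hK (X := n) (by exact_mod_cast hn)
      (F.filter fun I => I.absNorm ≤ n) (fun I hI => hF0 I (Finset.mem_filter.1 hI).1)
      (fun I hI => by exact_mod_cast (Finset.mem_filter.1 hI).2)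
    refine le_trans (le_of_eq ?_) hc
    rw [Finset.card_eq_sum_card_fiberwise (t := Finset.range n)
      (f := fun I : Ideal (𝓞 K) => I.absNorm - 1) fun I hI => hfib n _ (Finset.filter_subset _ _)
        (fun I hI => (Finset.mem_filter.1 hI).2) I hI]
    push_cast
    refine Finset.sum_congr rfl fun i hi => ?_
    congr 2
    ext I
    simp only [Finset.mem_filter, Finset.mem_range] at hi ⊢
    constructor
    · rintro ⟨hI, hIi⟩
      exact ⟨⟨hI, by omega⟩, hIi⟩
    · rintro ⟨⟨hI, -⟩, hIi⟩
      exact ⟨hI, hIi⟩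

lemma one_sub_rpow_le {q s : ℝ} (hq : 2 ≤ q) (hs : 0 ≤ s) :
    1 - q ^ (-(1 + s)) ≤ (1 - 1 / q) * Real.exp (2 * s * (Real.log q / q)) := by
  have hq0 : 0 < q := by linarith
  have hL : 0 ≤ Real.log q := Real.log_nonneg (by linarith)
  have ha : 1 / q ≤ 1 / 2 := one_div_le_one_div_of_le (by norm_num) hq
  have ha0 : 0 < 1 / q := by positivity
  have hb : 1 - s * Real.log q ≤ q ^ (-s) := by
    rw [Real.rpow_def_of_pos hq0]
    have := Real.add_one_le_exp (Real.log q * -s)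
    linarith
  have hexp := Real.add_one_le_exp (2 * s * (Real.log q / q))
  have h3 : q ^ (-(1 + s)) = 1 / q * q ^ (-s) := by
    rw [show -(1 + s) = -1 + -s by ring, Real.rpow_add hq0, Real.rpow_neg_one, one_div]
  have h4 : Real.log q / q = Real.log q * (1 / q) := by ring
  rw [h3]
  rw [h4] at hexp ⊢
  have h5 := mul_le_mul_of_nonneg_left hb ha0.le
  have h6 := mul_le_mul_of_nonneg_left hexp (by linarith : 0 ≤ 1 - 1 / q)
  have h7 : 0 ≤ s * Real.log q * (1 / q) := by positivity
  nlinarith [mul_nonneg h7 (by linarith : 0 ≤ 1 - 2 * (1 / q))]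

lemma prod_one_sub_inv_absNorm_le {K : Type*} [Field K] [NumberField K]
    (h2 : Module.finrank ℚ K = 2) (hK : IsEmpty (K →+* ℝ)) {s : ℝ} (hs : 0 < s)
    (S : Finset (Ideal (𝓞 K))) (hS : ∀ P ∈ S, P.IsPrime ∧ P ≠ ⊥) :
    ∏ P ∈ S, (1 - 1 / (P.absNorm : ℝ))⁻¹ ≤
      Real.exp (2 * s * ∑ P ∈ S, Real.log P.absNorm / P.absNorm) *
        (36 * classNumber K * (1 + 1 / s)) := by
  have hq : ∀ P ∈ S, (2 : ℝ) ≤ P.absNorm := fun P hP => by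
    have h0 : P.absNorm ≠ 0 := Ideal.absNorm_eq_zero_iff.not.2 (hS P hP).2
    have h1 : P.absNorm ≠ 1 := Ideal.absNorm_eq_one_iff.not.2 (hS P hP).1.ne_top
    exact_mod_cast (by omega : 2 ≤ P.absNorm)
  let w : Ideal (𝓞 K) →* ℝ :=
    { toFun := fun I => (I.absNorm : ℝ) ^ (-(1 + s))
      map_one' := by simp
      map_mul' := fun I J => by
        rw [map_mul, Nat.cast_mul, Real.mul_rpow (by positivity) (by positivity)] }
  have hw1 : ∀ P ∈ S, w P < 1 := fun P hP =>
    Real.rpow_lt_one_of_one_lt_of_neg (by linarith [hq P hP]) (by linarith)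
  have h := prod_one_sub_inv_le w (sum_absNorm_rpow_le h2 hK hs) S
    (fun P hP => Ideal.prime_of_isPrime (hS P hP).2 (hS P hP).1)
    (fun P _ => Real.rpow_nonneg (by positivity) _) hw1
  refine le_trans ?_ (mul_le_mul_of_nonneg_left h (Real.exp_nonneg _))
  rw [Finset.mul_sum, Real.exp_sum, ← Finset.prod_mul_distrib]
  have ha : ∀ P ∈ S, 0 < 1 - 1 / (P.absNorm : ℝ) := fun P hP => by
    have := one_div_le_one_div_of_le (by norm_num) (hq P hP)
    linarith
  refine Finset.prod_le_prod (fun P hP => (inv_pos.2 (ha P hP)).le) fun P hP => ?_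
  rw [← div_eq_mul_inv, le_div_iff₀ (sub_pos.2 (hw1 P hP)), inv_mul_le_iff₀ (ha P hP)]
  exact one_sub_rpow_le (hq P hP) hs.le

/-- There is an effective absolute constant `C > 0` such that for every imaginary
quadratic field `K` with class number `h_K` and every real `z ≥ 2`, one has
`∏_{𝔭 prime, |𝔭| ≤ z} (1 − 1/|𝔭|) ≥ C / (h_K · log z)`.  The (finite) product over the prime
ideals of norm at most `z` is expressed using `finprod`. -/
theorem prod_primes_norm_le_ge :
    ∃ C : ℝ, 0 < C ∧
      ∀ (K : Type) [Field K] [NumberField K],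
        Module.finrank ℚ K = 2 → IsEmpty (K →+* ℝ) →
        ∀ z : ℝ, 2 ≤ z →
          C / ((NumberField.classNumber K) * Real.log z) ≤
            ∏ᶠ (𝔭 : Ideal (𝓞 K)) (_ : 𝔭.IsPrime ∧ 𝔭 ≠ ⊥ ∧ (Ideal.absNorm 𝔭 : ℝ) ≤ z),
              (1 - 1 / (Ideal.absNorm 𝔭 : ℝ)) := by
  refine ⟨(Real.exp (12 * Real.log 4) * 108)⁻¹, by positivity, fun K _ _ h2 hK z hz => ?_⟩
  have hfin : {P : Ideal (𝓞 K) | P.IsPrime ∧ P ≠ ⊥ ∧ (Ideal.absNorm P : ℝ) ≤ z}.Finite :=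
    (Ideal.finite_setOfPred_absNorm_le ⌊z⌋₊).subset fun P hP => Nat.le_floor hP.2.2
  have hprod := finprod_mem_eq_finite_toFinset_prod
    (fun P : Ideal (𝓞 K) => 1 - 1 / (Ideal.absNorm P : ℝ)) hfin
  simp only [Set.mem_ofPred_eq] at hprod
  rw [hprod]
  set S := hfin.toFinset
  have hS : ∀ P ∈ S, P.IsPrime ∧ P ≠ ⊥ ∧ (Ideal.absNorm P : ℝ) ≤ z := fun P hP =>
    hfin.mem_toFinset.1 hP
  have hlogz : 1 / 2 ≤ Real.log z := by
    have := Real.log_le_log (by norm_num) hz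
    linarith [Real.log_two_gt_d9]
  have hlog0 : 0 < Real.log z := by linarith
  have hlog4 : 0 ≤ Real.log 4 := Real.log_nonneg (by norm_num)
  have hh : (0 : ℝ) < classNumber K := Nat.cast_pos.2 (classNumber_pos K)
  have hsum : ∑ P ∈ S, Real.log P.absNorm / P.absNorm ≤ 2 * (Real.log 4 * (3 * Real.log z)) := by
    refine (sum_log_absNorm_div_le S (fun P hP => ⟨(hS P hP).1, (hS P hP).2.1⟩)
      (Z := ⌊z⌋₊) fun P hP => Nat.le_floor (hS P hP).2.2).trans ?_
    rw [RingOfIntegers.rank, h2]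
    have hfl : Real.log ⌊z⌋₊ ≤ Real.log z :=
      Real.log_le_log (Nat.cast_pos.2 (Nat.floor_pos.2 (by linarith)))
        (Nat.floor_le (by linarith))
    push_cast
    refine mul_le_mul_of_nonneg_left ((sum_log_div_le _).trans ?_) (by norm_num)
    exact mul_le_mul_of_nonneg_left (by linarith) hlog4
  have hmain := prod_one_sub_inv_absNorm_le h2 hK (s := 1 / Real.log z) (by positivity) S
    fun P hP => ⟨(hS P hP).1, (hS P hP).2.1⟩
  have hexp : 2 * (1 / Real.log z) * ∑ P ∈ S, Real.log P.absNorm / P.absNorm ≤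
      12 * Real.log 4 := by
    refine (mul_le_mul_of_nonneg_left hsum (by positivity)).trans (le_of_eq ?_)
    field_simp
    norm_num
  have hbound : ∏ P ∈ S, (1 - 1 / (P.absNorm : ℝ))⁻¹ ≤
      Real.exp (12 * Real.log 4) * 108 * (classNumber K * Real.log z) := by
    refine hmain.trans ?_
    rw [mul_assoc (Real.exp _)]
    refine mul_le_mul (Real.exp_le_exp.2 hexp) ?_ (by positivity) (Real.exp_nonneg _)
    rw [one_div_one_div]
    nlinarith
  rw [Finset.prod_inv_distrib] at hbound
  have hpos : 0 < ∏ P ∈ S, (1 - 1 / (P.absNorm : ℝ)) := Finset.prod_pos fun P hP => by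
    have h0 : P.absNorm ≠ 0 := Ideal.absNorm_eq_zero_iff.not.2 (hS P hP).2.1
    have h1 : P.absNorm ≠ 1 := Ideal.absNorm_eq_one_iff.not.2 (hS P hP).1.ne_top
    have hq : (1 : ℝ) < P.absNorm := by exact_mod_cast (by omega : 1 < P.absNorm)
    exact sub_pos.2 ((div_lt_one (by linarith)).2 hq)
  rw [div_eq_mul_inv, ← mul_inv]
  exact inv_le_of_inv_le₀ hpos hbound
end
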